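/- arXiv:1603.07720 — 7 statements merged into one kernel-verified Lean document; each statement's English description precedes it below -/
import Mathlib

section
/- For every r ∈ ℕ there exists a set E ⊆ ℕ such that the density d(E) exists with 0 < d(E) < 1, the density d(E ∩ (E − n₁) ∩ ⋯ ∩ (E − n_ℓ)) exists for all ℓ ≤ r and all distinct n₁, …, n_ℓ ∈ ℕ, and for each ℓ = 1, …, r: (i) d(E ∩ (E − n₁) ∩ ⋯ ∩ (E − n_ℓ)) < d(E)^{ℓ+1} for all pairwise distinct n₁, …, n_ℓ ∈ ℕ; (ii) d(E ∩ (E − n₁) ∩ ⋯ ∩ (E − n_ℓ)) → d(E)^{ℓ+1} as min{n₁, n₂ − n₁, …, n_ℓ − n_{ℓ−1}} → ∞. Moreover, there exists a set E ⊆ ℕ satisfying property (i) with the strict inequality reversed, together with property (ii). -/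
open Filter Topology

/-- `E ⊆ ℕ` has (natural) density `δ` if `|E ∩ {1,…,N}| / N → δ`. -/
def HasDensity (E : Set ℕ) (δ : ℝ) : Prop :=
  Tendsto (fun N : ℕ => (Nat.card ↥(E ∩ Set.Icc 1 N) : ℝ) / N) atTop (𝓝 δ)

lemma indicator_one_mem_unit (B : Set ℕ) (n : ℕ) :
    0 ≤ B.indicator (1 : ℕ → ℝ) n ∧ B.indicator (1 : ℕ → ℝ) n ≤ 1 := by
  by_cases h : n ∈ B <;> simp [h]

lemma indicator_one_eq_of_iff {B B' : Set ℕ} {n n' : ℕ} (h : n ∈ B ↔ n' ∈ B') :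
    B.indicator (1 : ℕ → ℝ) n = B'.indicator (1 : ℕ → ℝ) n' := by
  by_cases h' : n' ∈ B' <;> simp [h, h']

/-- Partial sums of a bounded periodic sequence with vanishing mean are bounded by the period. -/
lemma abs_sum_range_le_of_periodic {f : ℕ → ℝ} {p : ℕ} (hp : 0 < p) (hf : ∀ n, f (n + p) = f n)
    (hsum : ∑ n ∈ Finset.range p, f n = 0) (hb : ∀ n, |f n| ≤ 1) (N : ℕ) :
    |∑ n ∈ Finset.range N, f n| ≤ p := by
  induction N using Nat.strong_induction_on with
  | _ N ih =>
    rcases lt_or_ge N p with h | h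
    · calc |∑ n ∈ Finset.range N, f n| ≤ ∑ n ∈ Finset.range N, |f n| :=
            Finset.abs_sum_le_sum_abs _ _
        _ ≤ ∑ n ∈ Finset.range N, (1 : ℝ) := Finset.sum_le_sum fun n _ => hb n
        _ = N := by simp
        _ ≤ p := by exact_mod_cast h.le
    · obtain ⟨m, rfl⟩ := Nat.exists_eq_add_of_le h
      rw [Finset.sum_range_add, hsum, zero_add]
      simpa [add_comm p, hf] using ih m (by omega)

/-- If the index `L` is nondecreasing, then switching between bounded mean-zero periodic sequences
costs at most twice the sum of the periods met so far. -/
lemma abs_sum_range_switch_le {f : ℕ → ℕ → ℝ} {p L : ℕ → ℕ} (hL : Monotone L)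
    (hG : ∀ i N, |∑ n ∈ Finset.range N, f i n| ≤ p i) (N : ℕ) :
    |∑ n ∈ Finset.range N, f (L n) n| ≤ 2 * ∑ i ∈ Finset.range (L N + 1), (p i : ℝ) := by
  have key : |∑ n ∈ Finset.range N, f (L n) n - ∑ n ∈ Finset.range N, f (L N) n| + p (L N)
      ≤ 2 * ∑ i ∈ Finset.range (L N + 1), (p i : ℝ) := by
    induction N with
    | zero =>
      have := Finset.single_le_sum (f := fun i => (p i : ℝ)) (fun i _ => Nat.cast_nonneg _)
        (Finset.self_mem_range_succ (L 0))
      have h0 : (0 : ℝ) ≤ p (L 0) := Nat.cast_nonneg _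
      simp only [Finset.range_zero, Finset.sum_empty, sub_zero, abs_zero] at *
      linarith
    | succ N ih =>
      rcases (hL N.le_succ).eq_or_lt with h | h
      · rw [← Nat.succ_eq_add_one, ← h, Finset.sum_range_succ, Finset.sum_range_succ _ N]
        simpa using ih
      · have h1 := hG (L N) (N + 1)
        have h2 := hG (L (N + 1)) (N + 1)
        have h3 : ∑ i ∈ Finset.range (L N + 1), (p i : ℝ) + p (L (N + 1)) ≤
            ∑ i ∈ Finset.range (L (N + 1) + 1), (p i : ℝ) := by
          rw [Finset.sum_range_succ _ (L (N + 1))]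
          gcongr
          exact h
        rw [Finset.sum_range_succ] at h1 ⊢
        rw [abs_le] at h1 h2
        have h4 := abs_le.1 (le_refl
          |∑ n ∈ Finset.range N, f (L n) n - ∑ n ∈ Finset.range N, f (L N) n|)
        have h5 : |∑ n ∈ Finset.range N, f (L n) n + f (L N) N
            - ∑ n ∈ Finset.range (N + 1), f (L (N + 1)) n| ≤
            |∑ n ∈ Finset.range N, f (L n) n - ∑ n ∈ Finset.range N, f (L N) n|
              + p (L N) + p (L (N + 1)) := by
          rw [abs_le]
          constructor <;> linarith
        linarith
  have h1 := hG (L N) N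
  have h2 := abs_add_le (∑ n ∈ Finset.range N, f (L n) n - ∑ n ∈ Finset.range N, f (L N) n)
    (∑ n ∈ Finset.range N, f (L N) n)
  rw [sub_add_cancel] at h2
  linarith

lemma sum_range_shift_sub_le {L : ℕ → ℕ} (hL : Monotone L) (m N : ℕ) :
    ∑ n ∈ Finset.range N, ((L (n + m) : ℝ) - L n) ≤ m * L (N + m) := by
  have h1 := Finset.sum_range_add (fun n => (L n : ℝ)) N m
  have h2 := Finset.sum_range_add (fun n => (L n : ℝ)) m N
  have h3 : ∑ x ∈ Finset.range m, (L (N + x) : ℝ) ≤ m * L (N + m) := by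
    calc _ ≤ ∑ x ∈ Finset.range m, (L (N + m) : ℝ) := by
          refine Finset.sum_le_sum fun x hx => ?_
          have := hL (show N + x ≤ N + m by have := Finset.mem_range.1 hx; omega)
          exact_mod_cast this
      _ = _ := by simp
  have h4 : (0 : ℝ) ≤ ∑ x ∈ Finset.range m, (L x : ℝ) :=
    Finset.sum_nonneg fun _ _ => Nat.cast_nonneg _
  rw [add_comm m N, h1] at h2
  rw [Finset.sum_sub_distrib]
  simp only [add_comm m] at h2
  linarith

/-- For any sequence of positive periods there is a nondecreasing unbounded index growing so slowly
that the total period met up to `n` is `o(n)`. -/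
lemma exists_slow_index (p : ℕ → ℕ) (hp : ∀ i, 0 < p i) :
    ∃ L : ℕ → ℕ, Monotone L ∧ Tendsto L atTop atTop ∧
      ∀ n, L n * ∑ i ∈ Finset.range (L n + 1), p i ≤ n := by
  classical
  have hle : ∀ K, K ≤ K * ∑ i ∈ Finset.range (K + 1), p i := fun K => by
    refine Nat.le_mul_of_pos_right K ?_
    exact Finset.sum_pos (fun i _ => hp i) ⟨0, by simp⟩
  refine ⟨fun n => Nat.findGreatest (fun K => K * ∑ i ∈ Finset.range (K + 1), p i ≤ n) n,
    ?_, ?_, ?_⟩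
  · intro a b hab
    exact Nat.findGreatest_mono (fun K hK => le_trans hK hab) hab
  · refine tendsto_atTop.2 fun K => ?_
    filter_upwards [eventually_ge_atTop (K * ∑ i ∈ Finset.range (K + 1), p i)] with n hn
    exact Nat.le_findGreatest ((hle K).trans hn) hn
  · intro n
    exact Nat.findGreatest_spec (P := fun K => K * ∑ i ∈ Finset.range (K + 1), p i ≤ n)
      (Nat.zero_le n) (by simp)

/-- Periodic sets whose pattern frequencies converge can be glued to a single set having
the limits as pattern densities. -/
theorem exists_set_of_periodic (F : ℕ → Set ℕ) (p : ℕ → ℕ) (hp : ∀ L, 0 < p L)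
    (hper : ∀ L n, n + p L ∈ F L ↔ n ∈ F L) :
    ∃ E : Set ℕ, ∀ (S : Finset ℕ) (c : ℝ),
      Tendsto (fun L => (∑ n ∈ Finset.range (p L),
        {n | ∀ s ∈ S, n + s ∈ F L}.indicator (1 : ℕ → ℝ) n) / p L) atTop (𝓝 c) →
      Tendsto (fun N : ℕ => (∑ n ∈ Finset.range N,
        {n | ∀ s ∈ S, n + s ∈ E}.indicator (1 : ℕ → ℝ) n) / N) atTop (𝓝 c) := by
  obtain ⟨L, hmono, htop, hslow⟩ := exists_slow_index p hp
  refine ⟨{n | n ∈ F (L n)}, fun S c hc => ?_⟩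
  set E : Set ℕ := {n | n ∈ F (L n)}
  set m := S.sup id
  have hm : ∀ s ∈ S, s ≤ m := fun s hs => Finset.le_sup (f := id) hs
  set a : ℕ → ℕ → ℝ := fun i => {n | ∀ s ∈ S, n + s ∈ F i}.indicator 1
  set d : ℕ → ℝ := fun i => (∑ n ∈ Finset.range (p i), a i n) / p i
  set A : ℕ → ℝ := {n | ∀ s ∈ S, n + s ∈ E}.indicator 1
  have ha : ∀ i n, 0 ≤ a i n ∧ a i n ≤ 1 := fun i n => indicator_one_mem_unit _ n
  have hd : ∀ i, 0 ≤ d i ∧ d i ≤ 1 := by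
    intro i
    have hpi : (0 : ℝ) < p i := by exact_mod_cast hp i
    refine ⟨div_nonneg (Finset.sum_nonneg fun n _ => (ha i n).1) hpi.le, ?_⟩
    rw [div_le_one hpi]
    calc _ ≤ ∑ n ∈ Finset.range (p i), (1 : ℝ) := Finset.sum_le_sum fun n _ => (ha i n).2
      _ = p i := by simp
  have hG : ∀ i N, |∑ n ∈ Finset.range N, (a i n - d i)| ≤ p i := by
    intro i
    have hpi : (0 : ℝ) < p i := by exact_mod_cast hp i
    refine abs_sum_range_le_of_periodic (hp i) (fun n => ?_) ?_ fun n => ?_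
    · have : n + p i ∈ {n | ∀ s ∈ S, n + s ∈ F i} ↔ n ∈ {n | ∀ s ∈ S, n + s ∈ F i} := by
        simp only [Set.mem_ofPred_eq, add_right_comm n (p i), hper]
      simp only [a, indicator_one_eq_of_iff this]
    · rw [Finset.sum_sub_distrib]
      simp [d, mul_div_cancel₀ _ hpi.ne']
    · rw [abs_le]
      have := ha i n
      have := hd i
      constructor <;> linarith
  have hswitch := abs_sum_range_switch_le hmono hG
  have hAa : ∀ n, |A n - a (L n) n| ≤ (L (n + m) : ℝ) - L n := by
    intro n
    rcases (hmono (Nat.le_add_right n m)).eq_or_lt with h | h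
    · have hs : ∀ s ∈ S, L (n + s) = L n := fun s hs => by
        have h1 := hmono (Nat.le_add_right n s)
        have h2 := hmono (Nat.add_le_add_left (hm s hs) n)
        omega
      have : n ∈ {n | ∀ s ∈ S, n + s ∈ E} ↔ n ∈ {n_1 | ∀ s ∈ S, n_1 + s ∈ F (L n)} := by
        simp only [Set.mem_ofPred_eq, E]
        exact forall₂_congr fun s h' => by rw [hs s h']
      simp only [A, a, indicator_one_eq_of_iff this, ← h, sub_self, abs_zero, le_refl]
    · have h1 : (L n : ℝ) + 1 ≤ L (n + m) := by exact_mod_cast h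
      have h2 := indicator_one_mem_unit {n | ∀ s ∈ S, n + s ∈ E} n
      have h3 := ha (L n) n
      have : |A n - a (L n) n| ≤ 1 := by
        rw [abs_le]
        constructor <;> simp only [A] <;> linarith
      linarith
  have hmain : ∀ N, |∑ n ∈ Finset.range N, A n - ∑ n ∈ Finset.range N, d (L n)| ≤
      m * L (N + m) + 2 * ∑ i ∈ Finset.range (L N + 1), (p i : ℝ) := by
    intro N
    have e : ∑ n ∈ Finset.range N, A n - ∑ n ∈ Finset.range N, d (L n) =
        ∑ n ∈ Finset.range N, (A n - a (L n) n) + ∑ n ∈ Finset.range N, (a (L n) n - d (L n)) := by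
      rw [← Finset.sum_add_distrib, ← Finset.sum_sub_distrib]
      exact Finset.sum_congr rfl fun n _ => by ring
    rw [e]
    refine (abs_add_le _ _).trans (add_le_add ?_ (hswitch N))
    exact (Finset.abs_sum_le_sum_abs _ _).trans
      ((Finset.sum_le_sum fun n _ => hAa n).trans (sum_range_shift_sub_le hmono m N))
  have hLinv : Tendsto (fun N => (1 : ℝ) / L N) atTop (𝓝 0) :=
    tendsto_one_div_atTop_nhds_zero_nat.comp htop
  have hLm : Tendsto (fun N => (1 : ℝ) / L (N + m)) atTop (𝓝 0) :=
    hLinv.comp (tendsto_add_atTop_nat m)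
  have hbound : Tendsto (fun N => (2 * m : ℝ) * (1 / L (N + m)) + 2 * (1 / L N)) atTop (𝓝 0) := by
    simpa using (hLm.const_mul (2 * m : ℝ)).add (hLinv.const_mul 2)
  have hces : Tendsto (fun N : ℕ => (N : ℝ)⁻¹ * ∑ n ∈ Finset.range N, d (L n)) atTop (𝓝 c) :=
    (hc.comp htop).cesaro
  have hdiff : Tendsto (fun N : ℕ => (∑ n ∈ Finset.range N, A n) / N -
      (N : ℝ)⁻¹ * ∑ n ∈ Finset.range N, d (L n)) atTop (𝓝 0) := by
    refine squeeze_zero_norm' ?_ hbound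
    filter_upwards [eventually_ge_atTop (m + 1), htop.eventually_ge_atTop 1] with N hN hLN
    have hN0 : (0 : ℝ) < N := by exact_mod_cast (by omega : 0 < N)
    have hL0 : (0 : ℝ) < L N := by exact_mod_cast hLN
    have hLm0 : (0 : ℝ) < L (N + m) := by
      exact_mod_cast lt_of_lt_of_le hLN (hmono (Nat.le_add_right N m))
    have e : (∑ n ∈ Finset.range N, A n) / N - (N : ℝ)⁻¹ * ∑ n ∈ Finset.range N, d (L n) =
        (∑ n ∈ Finset.range N, A n - ∑ n ∈ Finset.range N, d (L n)) / N := by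
      field_simp
    rw [e, Real.norm_eq_abs, abs_div, abs_of_pos hN0, div_le_iff₀ hN0]
    refine (hmain N).trans ?_
    have h1 : (L N : ℝ) * ∑ i ∈ Finset.range (L N + 1), (p i : ℝ) ≤ N := by
      exact_mod_cast hslow N
    have h2 : (L (N + m) : ℝ) * L (N + m) ≤ 2 * N := by
      have h3 : L (N + m) ≤ ∑ i ∈ Finset.range (L (N + m) + 1), p i := by
        calc L (N + m) ≤ ∑ i ∈ Finset.range (L (N + m) + 1), 1 := by simp
          _ ≤ _ := Finset.sum_le_sum fun i _ => hp i
      have h4 := (Nat.mul_le_mul_left (L (N + m)) h3).trans (hslow (N + m))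
      exact_mod_cast h4.trans (by omega)
    have h5 : (L (N + m) : ℝ) ≤ 2 * (1 / L (N + m)) * N := by
      rw [mul_one_div, div_mul_eq_mul_div, le_div_iff₀ hLm0]
      exact h2
    have h6 : ∑ i ∈ Finset.range (L N + 1), (p i : ℝ) ≤ 1 / L N * N := by
      rw [one_div_mul_eq_div, le_div_iff₀ hL0]
      linarith
    have h7 := mul_le_mul_of_nonneg_left h5 (Nat.cast_nonneg (α := ℝ) m)
    nlinarith
  simpa using hdiff.add hces

lemma Finset.exists_enumeration {α : Type*} (s : Finset α) (hs : s.Nonempty) :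
    ∃ e : ℕ → α, ∀ g : α → ℝ, ∑ m ∈ Finset.range s.card, g (e m) = ∑ ω ∈ s, g ω := by
  obtain ⟨x, -⟩ := hs
  refine ⟨fun m => if h : m < s.card then s.equivFin.symm ⟨m, h⟩ else x, fun g => ?_⟩
  rw [Finset.sum_range, ← Finset.sum_coe_sort s g]
  simp only [Fin.is_lt, dite_true, Fin.eta]
  exact Equiv.sum_comp s.equivFin.symm fun ω => g ω

lemma sum_range_mul_eq (f : ℕ → ℝ) (M q : ℕ) :
    ∑ n ∈ Finset.range (M * q), f n =
      ∑ i ∈ Finset.range q, ∑ m ∈ Finset.range M, f (i + q * m) := by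
  rw [Finset.sum_comm]
  induction M with
  | zero => simp
  | succ M ih =>
    rw [Nat.succ_mul, Finset.sum_range_add, ih, Finset.sum_range_succ]
    simp [mul_comm, add_comm]

/-- Finite families of words with convergent, position-independent pattern frequencies
give rise to a set having the limits as pattern densities. -/
theorem exists_set_of_words {α : Type*} (Ω : ℕ → Finset α) (hΩ : ∀ L, (Ω L).Nonempty)
    (X : α → Set ℕ) :
    ∃ E : Set ℕ, ∀ (S : Finset ℕ) (b : ℕ → ℝ) (c : ℝ),
      (∀ L n, (∀ s ∈ S, n + s ≤ L) →
        ∑ ω ∈ Ω L, {n | ∀ s ∈ S, n + s ∈ X ω}.indicator (1 : ℕ → ℝ) n = b L * (Ω L).card) →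
      Tendsto b atTop (𝓝 c) →
      Tendsto (fun N : ℕ => (∑ n ∈ Finset.range N,
        {n | ∀ s ∈ S, n + s ∈ E}.indicator (1 : ℕ → ℝ) n) / N) atTop (𝓝 c) := by
  choose e he using fun L => Finset.exists_enumeration (Ω L) (hΩ L)
  have hM : ∀ L, 0 < (Ω L).card := fun L => (hΩ L).card_pos
  obtain ⟨E, hE⟩ := exists_set_of_periodic
    (fun L => {n | n % (L + 1) ∈ X (e L (n / (L + 1) % (Ω L).card))})
    (fun L => (Ω L).card * (L + 1)) (fun L => Nat.mul_pos (hM L) L.succ_pos)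
    (fun L n => by
      simp only [Set.mem_ofPred_eq, Nat.add_mul_mod_self_right,
        Nat.add_mul_div_right _ _ L.succ_pos, Nat.add_mod_right])
  refine ⟨E, fun S b c hb hbc => hE S c ?_⟩
  set m := S.sup id
  have hm : ∀ s ∈ S, s ≤ m := fun s hs => Finset.le_sup (f := id) hs
  refine tendsto_of_tendsto_of_dist hbc (squeeze_zero_norm'
    (a := fun L : ℕ => m * (1 / ((L : ℝ) + 1))) ?_
    (by simpa using tendsto_one_div_add_atTop_nhds_zero_nat.const_mul (m : ℝ)))
  filter_upwards [eventually_ge_atTop m] with L hL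
  have hM0 : (0 : ℝ) < (Ω L).card := by exact_mod_cast hM L
  have hq0 : (0 : ℝ) < (L : ℝ) + 1 := by positivity
  have hbM : 0 ≤ b L * (Ω L).card ∧ b L * (Ω L).card ≤ (Ω L).card := by
    rw [← hb L 0 fun s hs => by have := hm s hs; omega]
    refine ⟨Finset.sum_nonneg fun ω _ => (indicator_one_mem_unit _ _).1, ?_⟩
    simpa using Finset.sum_le_sum (s := Ω L) fun ω _ =>
      (indicator_one_mem_unit {n | ∀ s ∈ S, n + s ∈ X ω} 0).2
  rw [sum_range_mul_eq]
  set T : ℕ → ℝ := fun i => ∑ j ∈ Finset.range (Ω L).card,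
    {n | ∀ s ∈ S, (n + s) % (L + 1) ∈ X (e L ((n + s) / (L + 1) % (Ω L).card))}.indicator
      (1 : ℕ → ℝ) (i + (L + 1) * j) with hT
  have hT1 : ∀ i, |T i - b L * (Ω L).card| ≤ (Ω L).card := by
    intro i
    have h1 : 0 ≤ T i := Finset.sum_nonneg fun _ _ => (indicator_one_mem_unit _ _).1
    have h2 : T i ≤ (Ω L).card := by
      calc T i ≤ ∑ j ∈ Finset.range (Ω L).card, (1 : ℝ) :=
            Finset.sum_le_sum fun _ _ => (indicator_one_mem_unit _ _).2
        _ = _ := by simp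
    rw [abs_le]
    constructor <;> linarith
  have hT0 : ∀ i, i + m ≤ L → T i = b L * (Ω L).card := by
    intro i hi
    have hi' : ∀ s ∈ S, i + s ≤ L := fun s hs => by have := hm s hs; omega
    rw [← hb L i hi', ← he L fun ω => {n | ∀ s ∈ S, n + s ∈ X ω}.indicator (1 : ℕ → ℝ) i]
    refine Finset.sum_congr rfl fun j hj => indicator_one_eq_of_iff ?_
    simp only [Set.mem_ofPred_eq]
    refine forall₂_congr fun s hs => ?_
    have h1 := hi' s hs
    have h2 : i + (L + 1) * j + s = (i + s) + (L + 1) * j := by ring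
    rw [h2, Nat.add_mul_mod_self_left,
      Nat.add_mul_div_left _ _ L.succ_pos, Nat.div_eq_of_lt (show i + s < L + 1 by omega), zero_add,
      Nat.mod_eq_of_lt (Finset.mem_range.1 hj), Nat.mod_eq_of_lt (show i + s < L + 1 by omega)]
  have hsum : |∑ i ∈ Finset.range (L + 1), T i - b L * (Ω L).card * (L + 1)| ≤
      m * (Ω L).card := by
    have e1 : ∑ i ∈ Finset.range (L + 1), T i - b L * (Ω L).card * (L + 1) =
        ∑ i ∈ Finset.range (L + 1), (T i - b L * (Ω L).card) := by
      rw [Finset.sum_sub_distrib]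
      simp [mul_comm]
    have e2 : L + 1 = (L + 1 - m) + m := by omega
    rw [e1, e2, Finset.sum_range_add, Finset.sum_eq_zero, zero_add]
    · refine (Finset.abs_sum_le_sum_abs _ _).trans ((Finset.sum_le_sum fun i _ => hT1 _).trans ?_)
      simp
    · intro i hi
      rw [hT0 i (by have := Finset.mem_range.1 hi; omega), sub_self]
  have e3 : b L - (∑ i ∈ Finset.range (L + 1), T i) / ((Ω L).card * (L + 1) : ℕ) =
      -((∑ i ∈ Finset.range (L + 1), T i - b L * (Ω L).card * (L + 1)) /
        ((Ω L).card * (L + 1))) := by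
    push_cast
    field_simp
    ring
  rw [Real.norm_eq_abs, abs_of_nonneg dist_nonneg, Real.dist_eq, e3, abs_neg, abs_div,
    abs_of_pos (mul_pos hM0 hq0), div_le_iff₀ (mul_pos hM0 hq0)]
  refine hsum.trans (le_of_eq ?_)
  field_simp

lemma summable_half_pow_succ : Summable fun k : ℕ => (1 / 2 : ℝ) ^ (k + 1) :=
  (summable_nat_add_iff 1).2 summable_geometric_two

lemma summable_half_pow_succ_mul {f : ℕ → ℝ} (hf : ∀ k, |f k| ≤ 1) :
    Summable fun k => (1 / 2 : ℝ) ^ (k + 1) * f k := by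
  refine Summable.of_norm_bounded summable_half_pow_succ fun k => ?_
  rw [norm_mul, Real.norm_eq_abs, Real.norm_eq_abs, abs_of_pos (by positivity)]
  exact mul_le_of_le_one_right (by positivity) (hf k)

/-- Mixtures with weights `2 ^ (-(k + 1))` of the stationary binary patterns `X k`, evaluated on
uniformly random words, are realised as pattern densities of a set. -/
theorem exists_set_of_mixture (X : ℕ → Finset ℕ → Set ℕ) (D : ℕ → Finset ℕ → ℝ)
    (hD : ∀ k S, |D k S| ≤ 1)
    (hX : ∀ (L k n : ℕ) (S : Finset ℕ), k ≤ L → (∀ s ∈ S, n + s ≤ L) →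
      ∑ u ∈ (Finset.range (2 * (L + 1))).powerset,
        {n | ∀ s ∈ S, n + s ∈ X k u}.indicator (1 : ℕ → ℝ) n = D k S * 2 ^ (2 * (L + 1)))
    (hDsucc : ∀ k S, D k (S.image (· + 1)) = D k S) :
    ∃ E : Set ℕ, ∀ S : Finset ℕ,
      HasDensity {m | ∀ s ∈ S, m + s ∈ E} (∑' k, (1 / 2 : ℝ) ^ (k + 1) * D k S) := by
  obtain ⟨E, hE⟩ := exists_set_of_words
    (fun L => (Finset.range (L + 1)).sigma (fun k => Finset.range (2 ^ (L - k))) ×ˢ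
      (Finset.range (2 * (L + 1))).powerset)
    (fun L => ⟨(⟨0, 0⟩, ∅), by simp⟩)
    (fun ω => X ω.1.1 ω.2)
  refine ⟨E, fun S => ?_⟩
  have hgeom : ∀ L : ℕ, ∑ k ∈ Finset.range (L + 1), (1 / 2 : ℝ) ^ (k + 1) =
      1 - (1 / 2) ^ (L + 1) := by
    intro L
    simp_rw [pow_succ' _ (_ : ℕ)]
    rw [← Finset.mul_sum, geom_sum_eq (by norm_num)]
    ring
  have hpow : ∀ L, ∀ k ∈ Finset.range (L + 1), (2 : ℝ) ^ (L - k) =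
      2 ^ (L + 1) * (1 / 2) ^ (k + 1) := by
    intro L k hk
    have : L + 1 = (L - k) + (k + 1) := by have := Finset.mem_range.1 hk; omega
    rw [this, pow_add, mul_assoc, ← mul_pow]
    norm_num
  have hsummable := summable_half_pow_succ_mul fun k => hD k S
  have key := hE (S.image (· + 1))
    (fun L => (∑ k ∈ Finset.range (L + 1), (1 / 2 : ℝ) ^ (k + 1) * D k S) /
      (1 - (1 / 2) ^ (L + 1)))
    (∑' k, (1 / 2 : ℝ) ^ (k + 1) * D k S) ?_ ?_
  · unfold HasDensity
    refine key.congr fun N => ?_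
    congr 1
    classical
    rw [Finset.sum_indicator_eq_sum_filter]
    simp only [Pi.one_apply, Finset.sum_const, nsmul_eq_mul, mul_one, Nat.cast_inj]
    have : ({m | ∀ s ∈ S, m + s ∈ E} ∩ Set.Icc 1 N) =
        ((Finset.range N).filter (· ∈ {n | ∀ s ∈ S.image (· + 1), n + s ∈ E})).map
          (addRightEmbedding 1) := by
      ext x
      simp only [Set.mem_inter_iff, Set.mem_ofPred_eq, Set.mem_Icc, Finset.coe_map,
        addRightEmbedding_apply, Set.mem_image, Finset.mem_coe, Finset.mem_filter,
        Finset.mem_range, Finset.forall_mem_image]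
      constructor
      · rintro ⟨h1, h2, h3⟩
        obtain ⟨y, rfl⟩ := Nat.exists_eq_add_of_le' h2
        exact ⟨y, ⟨by omega, fun s hs => by
          simpa [add_assoc, add_comm, add_left_comm] using h1 s hs⟩, rfl⟩
      · rintro ⟨y, ⟨h1, h2⟩, rfl⟩
        exact ⟨fun s hs => by simpa [add_assoc, add_comm, add_left_comm] using h2 hs,
          by omega, by omega⟩
    rw [this]
    simp only [Nat.card_eq_fintype_card, Fintype.card_coe, Finset.card_map, SetLike.coe_sort_coe]
  · intro L n hn
    rw [Finset.sum_product, Finset.sum_sigma, Finset.card_product, Finset.card_sigma]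
    have h1 : ∀ k ∈ Finset.range (L + 1), ∑ j ∈ Finset.range (2 ^ (L - k)),
        ∑ u ∈ (Finset.range (2 * (L + 1))).powerset,
          {n | ∀ s ∈ S.image (· + 1), n + s ∈ X k u}.indicator (1 : ℕ → ℝ) n =
        2 ^ (L + 1) * 2 ^ (2 * (L + 1)) * ((1 / 2) ^ (k + 1) * D k S) := by
      intro k hk
      rw [hX L k n _ (Nat.lt_succ_iff.1 (Finset.mem_range.1 hk)) hn, hDsucc, Finset.sum_const,
        Finset.card_range, nsmul_eq_mul]
      push_cast
      rw [hpow L k hk]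
      ring
    rw [Finset.sum_congr rfl h1, ← Finset.mul_sum]
    have h2 : (∑ k ∈ Finset.range (L + 1), (2 : ℝ) ^ (L - k)) =
        2 ^ (L + 1) * (1 - (1 / 2) ^ (L + 1)) := by
      rw [Finset.sum_congr rfl (hpow L), ← Finset.mul_sum, hgeom]
    have h3 : (1 - (1 / 2 : ℝ) ^ (L + 1)) ≠ 0 := by
      have : (1 / 2 : ℝ) ^ (L + 1) < 1 := pow_lt_one₀ (by norm_num) (by norm_num) (by omega)
      linarith
    simp only [Finset.card_range, Finset.card_powerset]
    push_cast
    rw [h2]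
    field_simp
  · have h1 := (tendsto_add_atTop_iff_nat 1).2 hsummable.hasSum.tendsto_sum_nat
    have h2 : Tendsto (fun L : ℕ => 1 - (1 / 2 : ℝ) ^ (L + 1)) atTop (𝓝 (1 - 0)) :=
      ((tendsto_add_atTop_iff_nat 1).2
        (tendsto_pow_atTop_nhds_zero_of_lt_one (by norm_num) (by norm_num))).const_sub 1
    have h3 := h1.div h2 (by norm_num)
    rw [sub_zero, div_one] at h3
    exact h3

lemma card_filter_powerset_interval {R A B : Finset ℕ} (hA : A ⊆ R) (hB : B ⊆ R)
    (hAB : Disjoint A B) :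
    ((R.powerset.filter fun u => A ⊆ u ∧ Disjoint B u).card : ℝ) =
      (1 / 2) ^ (A.card + B.card) * 2 ^ R.card := by
  have h1 : (R.powerset.filter fun u => A ⊆ u ∧ Disjoint B u) = Finset.Icc A (R \ B) := by
    ext u
    simp only [Finset.mem_filter, Finset.mem_powerset, Finset.mem_Icc,
      Finset.subset_sdiff, disjoint_comm (a := B)]
    tauto
  have h2 : A ⊆ R \ B := Finset.subset_sdiff.2 ⟨hA, hAB⟩
  have h3 : R.card = (A.card + B.card) + ((R \ B).card - A.card) := by
    have := Finset.card_sdiff_add_card_eq_card hB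
    have := Finset.card_le_card h2
    omega
  rw [h1, Finset.card_Icc_finset h2, h3, pow_add (2 : ℝ), ← mul_assoc, ← mul_pow]
  norm_num

lemma sum_powerset_indicator_eq {R : Finset ℕ} {Y : Finset ℕ → Set ℕ} {n : ℕ}
    {P : Finset ℕ → Prop} [DecidablePred P] (h : ∀ u, n ∈ Y u ↔ P u) :
    ∑ u ∈ R.powerset, (Y u).indicator (1 : ℕ → ℝ) n = ((R.powerset.filter P).card : ℝ) := by
  rw [Finset.card_filter]
  push_cast
  refine Finset.sum_congr rfl fun u _ => ?_
  by_cases hu : P u <;> simp [hu, (h u)]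

/-- The set of starting points of the pattern `10` at distance `d` realises, for every `S`,
negatively dependent densities. -/
theorem exists_set_of_repelling : ∃ E : Set ℕ, ∀ S : Finset ℕ,
    HasDensity {m | ∀ s ∈ S, m + s ∈ E} (∑' k, (1 / 2 : ℝ) ^ (k + 1) *
      if Disjoint S (S.image (· + (k + 1))) then (1 / 4 : ℝ) ^ S.card else 0) := by
  refine exists_set_of_mixture (fun k u => {n | n ∈ u ∧ n + (k + 1) ∉ u}) _ ?_ ?_ ?_
  · intro k S
    split_ifs
    · rw [abs_of_nonneg (by positivity)]
      exact pow_le_one₀ (by norm_num) (by norm_num)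
    · simp
  · intro L k n S hk hS
    have hinj : Function.Injective (n + · : ℕ → ℕ) := add_right_injective n
    rw [sum_powerset_indicator_eq (P := fun u => S.image (n + ·) ⊆ u ∧
      Disjoint ((S.image (· + (k + 1))).image (n + ·)) u)]
    · split_ifs with h
      · rw [card_filter_powerset_interval]
        · simp only [Finset.card_image_of_injective _ hinj,
            Finset.card_image_of_injective _ (add_left_injective (k + 1)), Finset.card_range]
          rw [← two_mul, pow_mul]
          norm_num
        · intro x hx
          obtain ⟨s, hs, rfl⟩ := Finset.mem_image.1 hx
          have := hS s hs
          simp only [Finset.mem_range]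
          omega
        · intro x hx
          simp only [Finset.image_image, Finset.mem_image, Function.comp] at hx
          obtain ⟨s, hs, rfl⟩ := hx
          have := hS s hs
          simp only [Finset.mem_range]
          omega
        · exact (Finset.disjoint_image hinj).2 h
      · rw [zero_mul, Nat.cast_eq_zero, Finset.card_eq_zero, Finset.filter_eq_empty_iff]
        rintro u - ⟨h1, h2⟩
        exact h ((Finset.disjoint_image hinj).1 (Finset.disjoint_of_subset_left h1 h2.symm))
    · intro u
      simp only [Set.mem_ofPred_eq, Finset.subset_iff, Finset.disjoint_left, Finset.mem_image,
        forall_exists_index, and_imp,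
        forall_apply_eq_imp_iff₂, add_assoc]
      exact ⟨fun h => ⟨fun s hs => (h s hs).1, fun s hs => (h s hs).2⟩,
        fun h s hs => ⟨h.1 s hs, h.2 s hs⟩⟩
  · intro k S
    have h : (S.image (· + 1)).image (· + (k + 1)) = (S.image (· + (k + 1))).image (· + 1) := by
      simp only [Finset.image_image, Function.comp_def, add_right_comm]
    simp only [h, Finset.disjoint_image (add_left_injective 1),
      Finset.card_image_of_injective _ (add_left_injective 1)]

/-- The set of starting points of the pattern `11` at distance `d` realises, for every `S`,
positively dependent densities. -/
theorem exists_set_of_attracting : ∃ E : Set ℕ, ∀ S : Finset ℕ,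
    HasDensity {m | ∀ s ∈ S, m + s ∈ E} (∑' k, (1 / 2 : ℝ) ^ (k + 1) *
      (1 / 2 : ℝ) ^ (S ∪ S.image (· + (k + 1))).card) := by
  refine exists_set_of_mixture (fun k u => {n | n ∈ u ∧ n + (k + 1) ∈ u})
    (fun k S => (1 / 2 : ℝ) ^ (S ∪ S.image (· + (k + 1))).card) ?_ ?_ ?_
  · intro k S
    rw [abs_of_nonneg (by positivity)]
    exact pow_le_one₀ (by norm_num) (by norm_num)
  · intro L k n S hk hS
    have hinj : Function.Injective (n + · : ℕ → ℕ) := add_right_injective n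
    rw [sum_powerset_indicator_eq (P := fun u =>
      (S ∪ S.image (· + (k + 1))).image (n + ·) ⊆ u ∧ Disjoint ∅ u)]
    · rw [card_filter_powerset_interval _ (Finset.empty_subset _) (Finset.disjoint_empty_right _)]
      · simp only [Finset.card_image_of_injective _ hinj, Finset.card_range, Finset.card_empty,
          add_zero]
      · intro x hx
        simp only [Finset.image_union, Finset.image_image, Finset.mem_union, Finset.mem_image,
          Function.comp] at hx
        simp only [Finset.mem_range]
        rcases hx with ⟨s, hs, rfl⟩ | ⟨s, hs, rfl⟩ <;> have := hS s hs <;> omega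
    · intro u
      rw [Finset.image_union, Finset.union_subset_iff]
      simp only [Set.mem_ofPred_eq, Finset.subset_iff, Finset.mem_image,
        Finset.disjoint_empty_left, and_true, forall_exists_index, and_imp,
        forall_apply_eq_imp_iff₂, add_assoc]
      exact ⟨fun h => ⟨fun s hs => (h s hs).1, fun s hs => (h s hs).2⟩,
        fun h s hs => ⟨h.1 s hs, h.2 s hs⟩⟩
  · intro k S
    have h : (S.image (· + 1)).image (· + (k + 1)) = (S.image (· + (k + 1))).image (· + 1) := by
      simp only [Finset.image_image, Function.comp_def, add_right_comm]
    simp only [h, ← Finset.image_union,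
      Finset.card_image_of_injective _ (add_left_injective 1)]

lemma tsum_half_pow_succ_mul (c : ℝ) : ∑' k : ℕ, (1 / 2 : ℝ) ^ (k + 1) * c = c := by
  rw [tsum_mul_right]
  simp_rw [pow_succ]
  rw [tsum_mul_right, tsum_geometric_two]
  norm_num

/-- A geometric mixture of `[0, 1]`-valued quantities which equal `c` up to index `N` is
within `2 ^ (-N)` of `c`. -/
lemma abs_tsum_half_pow_succ_mul_sub_le {f : ℕ → ℝ} {c : ℝ} {N : ℕ}
    (hf : ∀ k, 0 ≤ f k ∧ f k ≤ 1) (hc : 0 ≤ c ∧ c ≤ 1) (hfc : ∀ k < N, f k = c) :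
    |∑' k, (1 / 2 : ℝ) ^ (k + 1) * f k - c| ≤ (1 / 2) ^ N := by
  have h1 : ∀ k, |f k - c| ≤ 1 := fun k => by
    have := hf k
    rw [abs_le]
    constructor <;> linarith
  have h2 : ∑' k, (1 / 2 : ℝ) ^ (k + 1) * f k - c = ∑' k, (1 / 2 : ℝ) ^ (k + 1) * (f k - c) := by
    nth_rewrite 1 [← tsum_half_pow_succ_mul c]
    rw [← Summable.tsum_sub]
    · exact tsum_congr fun k => by ring
    · exact summable_half_pow_succ_mul fun k => abs_le.2 ⟨by linarith [hf k], (hf k).2⟩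
    · exact summable_half_pow_succ.mul_right c
  have hs := summable_half_pow_succ_mul h1
  have h3 : ∑' k, (1 / 2 : ℝ) ^ (k + 1) * (f k - c) =
      (1 / 2) ^ N * ∑' k, (1 / 2 : ℝ) ^ (k + 1) * (f (k + N) - c) := by
    rw [← hs.sum_add_tsum_nat_add N, Finset.sum_eq_zero, zero_add, ← tsum_mul_left]
    · exact tsum_congr fun k => by ring
    · intro k hk
      rw [hfc k (Finset.mem_range.1 hk), sub_self, mul_zero]
  rw [h2, h3, abs_mul, abs_of_pos (by positivity)]
  refine mul_le_of_le_one_right (by positivity) ?_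
  have hs' := summable_half_pow_succ_mul fun k => h1 (k + N)
  rw [← Real.norm_eq_abs]
  refine (tsum_of_norm_bounded (summable_half_pow_succ.mul_right 1).hasSum fun k => ?_).trans_eq
    (tsum_half_pow_succ_mul 1)
  rw [norm_mul, Real.norm_eq_abs, Real.norm_eq_abs, abs_of_pos (by positivity)]
  gcongr
  exact h1 _

/-- The pattern `{0, n₀, …, n_{ℓ-1}}` of a tuple of shifts. -/
def shiftPattern {ℓ : ℕ} (n : Fin ℓ → ℕ) : Finset ℕ :=
  insert 0 (Finset.univ.image n)

lemma inter_shifts_eq_shiftPattern (E : Set ℕ) {ℓ : ℕ} (n : Fin ℓ → ℕ) :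
    (E ∩ ⋂ i, {m | m + n i ∈ E}) = {m | ∀ s ∈ shiftPattern n, m + s ∈ E} := by
  ext m
  simp [shiftPattern]

lemma card_shiftPattern {ℓ : ℕ} {n : Fin ℓ → ℕ} (hn : ∀ i, 1 ≤ n i)
    (hinj : Function.Injective n) : (shiftPattern n).card = ℓ + 1 := by
  rw [shiftPattern, Finset.card_insert_of_notMem, Finset.card_image_of_injective _ hinj,
    Finset.card_fin]
  simp only [Finset.mem_image, Finset.mem_univ, true_and, not_exists]
  intro i hi
  have := hn i
  omega

lemma add_le_of_consecutive_gaps {ℓ N : ℕ} {n : Fin ℓ → ℕ}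
    (hgap : ∀ i j : Fin ℓ, (i : ℕ) + 1 = (j : ℕ) → n i < n j ∧ N ≤ n j - n i) {i j : Fin ℓ}
    (hij : i < j) : n i + N ≤ n j := by
  have key : ∀ d : ℕ, ∀ j : Fin ℓ, (j : ℕ) = i + d + 1 → n i + N ≤ n j := by
    intro d
    induction d with
    | zero =>
      intro j hj
      have := hgap i j (by omega)
      omega
    | succ d ih =>
      intro j hj
      have h1 := ih ⟨i + d + 1, by omega⟩ rfl
      have h2 := hgap ⟨i + d + 1, by omega⟩ j (by simp only; omega)
      omega
  exact key (j - i - 1) j (by have : (i : ℕ) < j := hij; omega)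

lemma disjoint_shiftPattern_shift {ℓ N : ℕ} {n : Fin ℓ → ℕ} (h0 : ∀ h : 0 < ℓ, N ≤ n ⟨0, h⟩)
    (hgap : ∀ i j : Fin ℓ, (i : ℕ) + 1 = (j : ℕ) → n i < n j ∧ N ≤ n j - n i) {k : ℕ}
    (hk : k + 1 < N) : Disjoint (shiftPattern n) ((shiftPattern n).image (· + (k + 1))) := by
  have hN : ∀ i, N ≤ n i := by
    intro i
    have h := h0 i.pos
    rcases Nat.eq_zero_or_pos (i : ℕ) with hi | hi
    · have : i = ⟨0, i.pos⟩ := Fin.ext hi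
      rw [this]
      exact h
    · have := add_le_of_consecutive_gaps hgap (i := ⟨0, i.pos⟩) (j := i) hi
      omega
  rw [Finset.disjoint_left]
  intro a ha ha'
  obtain ⟨b, hb, rfl⟩ := Finset.mem_image.1 ha'
  simp only [shiftPattern, Finset.mem_insert, Finset.mem_image, Finset.mem_univ, true_and] at ha hb
  rcases ha with ha | ⟨i, hi⟩
  · omega
  rcases hb with rfl | ⟨j, rfl⟩
  · have := hN i
    omega
  · rcases lt_trichotomy i j with h | rfl | h
    · have := add_le_of_consecutive_gaps hgap h
      omega
    · omega
    · have := add_le_of_consecutive_gaps hgap h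
      omega

/-- For a nonempty tuple of positive shifts, the pattern meets its translate by any of the shifts. -/
lemma not_disjoint_shiftPattern_shift {ℓ : ℕ} {n : Fin ℓ → ℕ} (i : Fin ℓ) (hn : 1 ≤ n i) :
    ¬ Disjoint (shiftPattern n) ((shiftPattern n).image (· + ((n i - 1) + 1))) := by
  rw [Finset.not_disjoint_iff]
  refine ⟨n i, by simp [shiftPattern], Finset.mem_image.2 ⟨0, by simp [shiftPattern], ?_⟩⟩
  omega

/-- Pattern densities which are geometric mixtures of quantities equal to `4 ^ (-|S|)` whenever
`S` misses its translate converge to the independent value along sparse patterns. -/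
lemma abs_density_sub_lt_of_sparse {E : Set ℕ} {D : ℕ → Finset ℕ → ℝ}
    (hE : ∀ S : Finset ℕ,
      HasDensity {m | ∀ s ∈ S, m + s ∈ E} (∑' k, (1 / 2 : ℝ) ^ (k + 1) * D k S))
    (h01 : ∀ k S, 0 ≤ D k S ∧ D k S ≤ 1)
    (hdisj : ∀ k S, Disjoint S (S.image (· + (k + 1))) → D k S = (1 / 4) ^ S.card)
    (ℓ : ℕ) (ε : ℝ) (hε : 0 < ε) :
    ∃ N : ℕ, ∀ n : Fin ℓ → ℕ, (∀ h : 0 < ℓ, N ≤ n ⟨0, h⟩) →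
      (∀ i j : Fin ℓ, (i : ℕ) + 1 = (j : ℕ) → n i < n j ∧ N ≤ n j - n i) →
      ∀ c : ℝ, HasDensity (E ∩ ⋂ i, {m | m + n i ∈ E}) c → |c - (1 / 4) ^ (ℓ + 1)| < ε := by
  obtain ⟨N, hN⟩ := exists_pow_lt_of_lt_one hε (by norm_num : (1 / 2 : ℝ) < 1)
  refine ⟨N + 1, fun n h0 hgap c hc => ?_⟩
  rw [inter_shifts_eq_shiftPattern] at hc
  have hcard : (shiftPattern n).card = ℓ + 1 := by
    have hmono : StrictMono n := fun i j hij => by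
      have := add_le_of_consecutive_gaps hgap hij
      omega
    refine card_shiftPattern (fun i => ?_) hmono.injective
    have h1 := h0 i.pos
    have h2 := hmono.monotone (show (⟨0, i.pos⟩ : Fin ℓ) ≤ i from Nat.zero_le _)
    omega
  rw [tendsto_nhds_unique hc (hE _)]
  refine lt_of_le_of_lt (abs_tsum_half_pow_succ_mul_sub_le (fun k => h01 k _)
    ⟨by positivity, pow_le_one₀ (by norm_num) (by norm_num)⟩ fun k hk => ?_) hN
  rw [hdisj k _ (disjoint_shiftPattern_shift h0 hgap (by omega)), hcard]

lemma hasDensity_of_forall_pattern {E : Set ℕ} {D : ℕ → Finset ℕ → ℝ}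
    (hE : ∀ S : Finset ℕ,
      HasDensity {m | ∀ s ∈ S, m + s ∈ E} (∑' k, (1 / 2 : ℝ) ^ (k + 1) * D k S))
    (hdisj : ∀ k S, Disjoint S (S.image (· + (k + 1))) → D k S = (1 / 4) ^ S.card) :
    HasDensity E (1 / 4) := by
  have h := hE {0}
  rw [tsum_congr fun k => by rw [hdisj k {0} (by simp)], tsum_half_pow_succ_mul] at h
  simpa using h

theorem stmt_12 (r : ℕ) :
    (∃ (E : Set ℕ) (δ : ℝ),
      HasDensity E δ ∧ 0 < δ ∧ δ < 1 ∧
      ∀ ℓ : ℕ, 1 ≤ ℓ → ℓ ≤ r →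
        -- (i) strict multiple under-recurrence
        (∀ n : Fin ℓ → ℕ, (∀ i, 1 ≤ n i) → Function.Injective n →
          ∃ c : ℝ, HasDensity (E ∩ ⋂ i, {m | m + n i ∈ E}) c ∧ c < δ ^ (ℓ + 1)) ∧
        -- (ii) convergence as the minimal gap tends to infinity
        (∀ ε > (0 : ℝ), ∃ N : ℕ, ∀ n : Fin ℓ → ℕ,
          (∀ h : 0 < ℓ, N ≤ n ⟨0, h⟩) →
          (∀ i j : Fin ℓ, (i : ℕ) + 1 = (j : ℕ) → n i < n j ∧ N ≤ n j - n i) →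
          ∀ c : ℝ, HasDensity (E ∩ ⋂ i, {m | m + n i ∈ E}) c →
            |c - δ ^ (ℓ + 1)| < ε)) ∧
    (∃ (E : Set ℕ) (δ : ℝ),
      HasDensity E δ ∧ 0 < δ ∧ δ < 1 ∧
      ∀ ℓ : ℕ, 1 ≤ ℓ → ℓ ≤ r →
        -- (i) strict multiple over-recurrence
        (∀ n : Fin ℓ → ℕ, (∀ i, 1 ≤ n i) → Function.Injective n →
          ∃ c : ℝ, HasDensity (E ∩ ⋂ i, {m | m + n i ∈ E}) c ∧ c > δ ^ (ℓ + 1)) ∧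
        -- (ii) convergence as the minimal gap tends to infinity
        (∀ ε > (0 : ℝ), ∃ N : ℕ, ∀ n : Fin ℓ → ℕ,
          (∀ h : 0 < ℓ, N ≤ n ⟨0, h⟩) →
          (∀ i j : Fin ℓ, (i : ℕ) + 1 = (j : ℕ) → n i < n j ∧ N ≤ n j - n i) →
          ∀ c : ℝ, HasDensity (E ∩ ⋂ i, {m | m + n i ∈ E}) c →
            |c - δ ^ (ℓ + 1)| < ε)) := by
  refine ⟨?_, ?_⟩
  · obtain ⟨E, hE⟩ := exists_set_of_repelling
    have h01 : ∀ (k : ℕ) (S : Finset ℕ),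
        0 ≤ (if Disjoint S (S.image (· + (k + 1))) then (1 / 4 : ℝ) ^ S.card else 0) ∧
        (if Disjoint S (S.image (· + (k + 1))) then (1 / 4 : ℝ) ^ S.card else 0) ≤ 1 := by
      intro k S
      have : (1 / 4 : ℝ) ^ S.card ≤ 1 := pow_le_one₀ (by norm_num) (by norm_num)
      split_ifs
      · exact ⟨by positivity, this⟩
      · simp
    have hdisj : ∀ (k : ℕ) (S : Finset ℕ), Disjoint S (S.image (· + (k + 1))) →
        (if Disjoint S (S.image (· + (k + 1))) then (1 / 4 : ℝ) ^ S.card else 0) =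
          (1 / 4) ^ S.card := fun k S h => if_pos h
    refine ⟨E, 1 / 4, hasDensity_of_forall_pattern hE hdisj, by norm_num, by norm_num,
      fun ℓ hℓ _ => ⟨fun n hn hinj => ?_, abs_density_sub_lt_of_sparse hE h01 hdisj ℓ⟩⟩
    rw [inter_shifts_eq_shiftPattern]
    refine ⟨_, hE _, ?_⟩
    rw [← card_shiftPattern hn hinj]
    refine lt_of_lt_of_eq ?_ (tsum_half_pow_succ_mul ((1 / 4) ^ (shiftPattern n).card))
    refine Summable.tsum_lt_tsum (i := n ⟨0, hℓ⟩ - 1) (fun k => ?_) ?_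
      (summable_half_pow_succ_mul fun k => abs_le.2 ⟨by linarith [h01 k (shiftPattern n)],
        (h01 k _).2⟩) (summable_half_pow_succ.mul_right _)
    · gcongr
      split_ifs
      · exact le_rfl
      · positivity
    · rw [if_neg (not_disjoint_shiftPattern_shift _ (hn _)), mul_zero]
      positivity
  · obtain ⟨E, hE⟩ := exists_set_of_attracting
    have h01 : ∀ (k : ℕ) (S : Finset ℕ),
        0 ≤ (1 / 2 : ℝ) ^ (S ∪ S.image (· + (k + 1))).card ∧
        (1 / 2 : ℝ) ^ (S ∪ S.image (· + (k + 1))).card ≤ 1 :=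
      fun k S => ⟨by positivity, pow_le_one₀ (by norm_num) (by norm_num)⟩
    have hfour : ∀ m : ℕ, (1 / 4 : ℝ) ^ m = (1 / 2) ^ (m + m) := fun m => by
      rw [← two_mul, pow_mul]
      norm_num
    have hcard : ∀ (k : ℕ) (S : Finset ℕ), (S.image (· + (k + 1))).card = S.card :=
      fun k S => Finset.card_image_of_injective _ (add_left_injective (k + 1))
    have hdisj : ∀ (k : ℕ) (S : Finset ℕ), Disjoint S (S.image (· + (k + 1))) →
        (1 / 2 : ℝ) ^ (S ∪ S.image (· + (k + 1))).card = (1 / 4) ^ S.card := fun k S h => by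
      rw [Finset.card_union_of_disjoint h, hcard, hfour]
    refine ⟨E, 1 / 4, hasDensity_of_forall_pattern hE hdisj, by norm_num, by norm_num,
      fun ℓ hℓ _ => ⟨fun n hn hinj => ?_, abs_density_sub_lt_of_sparse hE h01 hdisj ℓ⟩⟩
    rw [inter_shifts_eq_shiftPattern]
    refine ⟨_, hE _, ?_⟩
    rw [gt_iff_lt, ← card_shiftPattern hn hinj, ← tsum_half_pow_succ_mul ((1 / 4) ^ _)]
    refine Summable.tsum_lt_tsum (i := n ⟨0, hℓ⟩ - 1) (fun k => ?_) ?_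
      (summable_half_pow_succ.mul_right _)
      (summable_half_pow_succ_mul fun k => abs_le.2 ⟨by linarith [h01 k (shiftPattern n)],
        (h01 k _).2⟩)
    · rw [hfour]
      refine mul_le_mul_of_nonneg_left (pow_le_pow_of_le_one (by norm_num) (by norm_num) ?_)
        (by positivity)
      exact (Finset.card_union_le _ _).trans_eq (by rw [hcard])
    · rw [hfour]
      refine mul_lt_mul_of_pos_left (pow_lt_pow_right_of_lt_one₀ (by norm_num) (by norm_num) ?_)
        (by positivity)
      have h := Finset.card_union_add_card_inter (shiftPattern n)
        ((shiftPattern n).image (· + ((n ⟨0, hℓ⟩ - 1) + 1)))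
      have h' : 0 < ((shiftPattern n) ∩
          ((shiftPattern n).image (· + ((n ⟨0, hℓ⟩ - 1) + 1)))).card := by
        rw [Finset.card_pos, ← Finset.not_disjoint_iff_nonempty_inter]
        exact not_disjoint_shiftPattern_shift _ (hn _)
      rw [hcard] at h
      omega
end

section
/- Let σ be a probability measure on the circle 𝕋 = ℝ/ℤ such that c_n := ∫ cos(2πnt) dσ(t) ≤ 0 for every n ≥ 1 (equivalently, Re σ̂(n) ≤ 0 for every n ≥ 1). Then ∑_{n=1}^∞ |c_n| ≤ 1/2. -/
open MeasureTheory

/-- For `w` on the unit circle, `w ^ N` times the conjugate of `∑_{k<N} w ^ k` is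
`w + ⋯ + w ^ N`. -/
lemma pow_mul_conj_geom_sum {w : ℂ} (hw : w * (starRingEnd ℂ) w = 1) (N : ℕ) :
    w ^ N * (starRingEnd ℂ) (∑ k ∈ Finset.range N, w ^ k) =
      ∑ n ∈ Finset.range N, w ^ (n + 1) := by
  induction N with
  | zero => simp
  | succ N ih =>
    have hN : w ^ N * (starRingEnd ℂ) w ^ N = 1 := by rw [← mul_pow, hw, one_pow]
    have hshift : ∑ n ∈ Finset.range N, w ^ (n + 1 + 1) =
        w * ∑ n ∈ Finset.range N, w ^ (n + 1) := by
      simp only [Finset.mul_sum, pow_succ' w (_ + 1)]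
    rw [Finset.sum_range_succ' (fun n => w ^ (n + 1)), hshift, ← ih, Finset.sum_range_succ,
      map_add, map_pow]
    linear_combination w * hN

/-- The Fejér kernel identity on the unit circle. -/
lemma sum_one_add_two_mul_sum_re_pow {w : ℂ} (hw : w * (starRingEnd ℂ) w = 1) (N : ℕ) :
    ∑ m ∈ Finset.range N, (1 + 2 * ∑ n ∈ Finset.range m, (w ^ (n + 1)).re) =
      Complex.normSq (∑ k ∈ Finset.range N, w ^ k) := by
  induction N with
  | zero => simp
  | succ N ih =>
    have h1 : Complex.normSq (w ^ N) = 1 := by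
      have hn : Complex.normSq w = 1 := by
        rw [Complex.mul_conj] at hw
        exact_mod_cast hw
      rw [map_pow, hn, one_pow]
    rw [Finset.sum_range_succ, ih, Finset.sum_range_succ, add_comm _ (w ^ N),
      Complex.normSq_add, pow_mul_conj_geom_sum hw, h1, Complex.re_sum]
    ring

/-- If the averages of `1 - 2 * S` are nonnegative and `S` is monotone, then `S ≤ 1 / 2`. -/
lemma le_half_of_monotone_of_sum_nonneg {S : ℕ → ℝ} (hS : Monotone S) (h0 : ∀ m, 0 ≤ S m)
    (h : ∀ N, 0 ≤ ∑ m ∈ Finset.range N, (1 - 2 * S m)) (M : ℕ) : S M ≤ 1 / 2 := by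
  by_contra! hM
  obtain ⟨K, hK⟩ := exists_nat_gt ((M : ℝ) / (2 * S M - 1))
  rw [div_lt_iff₀ (by linarith)] at hK
  have hsum := h (M + K)
  rw [Finset.sum_range_add] at hsum
  have hfirst : ∑ m ∈ Finset.range M, (1 - 2 * S m) ≤ M := by
    simpa using Finset.sum_le_card_nsmul (Finset.range M) (fun m => 1 - 2 * S m) 1
      fun m _ => by linarith [h0 m]
  have hlast : ∑ k ∈ Finset.range K, (1 - 2 * S (M + k)) ≤ K * (1 - 2 * S M) := by
    simpa using Finset.sum_le_card_nsmul (Finset.range K) (fun k => 1 - 2 * S (M + k))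
      (1 - 2 * S M) fun k _ => by linarith [hS (Nat.le_add_right M k)]
  linarith

theorem stmt_13 (σ : Measure (AddCircle (1 : ℝ))) [IsProbabilityMeasure σ]
    (hneg : ∀ n : ℕ, 1 ≤ n → (∫ t, (fourier (n : ℤ) t).re ∂σ) ≤ 0) :
    (Summable fun n : ℕ => |∫ t, (fourier ((n : ℤ) + 1) t).re ∂σ|) ∧
    (∑' n : ℕ, |∫ t, (fourier ((n : ℤ) + 1) t).re ∂σ|) ≤ 1 / 2 := by
  have hle : ∀ n : ℕ, ∫ t, (fourier ((n : ℤ) + 1) t).re ∂σ ≤ 0 := fun n => by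
    exact_mod_cast hneg (n + 1) (by omega)
  have hint : ∀ n : ℕ, Integrable
      (fun t : AddCircle (1 : ℝ) => (fourier ((n : ℤ) + 1) t).re) σ := fun n =>
    (Complex.continuous_re.comp (fourier ((n : ℤ) + 1)).continuous).integrable_of_hasCompactSupport
      (HasCompactSupport.of_compactSpace _)
  have hpow : ∀ (n : ℕ) (t : AddCircle (1 : ℝ)),
      fourier ((n : ℤ) + 1) t = fourier 1 t ^ (n + 1) := by
    intro n t
    induction n with
    | zero => simp
    | succ n ih => rw [fourier_add, Nat.cast_succ, ih, pow_succ _ (n + 1)]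
  have hunit : ∀ t : AddCircle (1 : ℝ),
      fourier 1 t * (starRingEnd ℂ) (fourier 1 t) = (1 : ℂ) := fun t => by
    rw [← fourier_neg, ← fourier_add, add_neg_cancel, fourier_zero]
  have hbound : ∀ N : ℕ,
      ∑ n ∈ Finset.range N, |∫ t, (fourier ((n : ℤ) + 1) t).re ∂σ| ≤ 1 / 2 := by
    refine le_half_of_monotone_of_sum_nonneg
      (monotone_nat_of_le_succ fun N => ?_) (fun N => Finset.sum_nonneg fun _ _ => abs_nonneg _)
      fun N => ?_
    · rw [Finset.sum_range_succ]
      exact le_add_of_nonneg_right (abs_nonneg _)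
    · have hpos : 0 ≤ ∫ t, ∑ m ∈ Finset.range N,
          (1 + 2 * ∑ n ∈ Finset.range m, (fourier ((n : ℤ) + 1) t).re) ∂σ := by
        refine integral_nonneg fun t => ?_
        simp only [hpow]
        rw [sum_one_add_two_mul_sum_re_pow (hunit t)]
        exact Complex.normSq_nonneg _
      have hsum : ∀ m : ℕ, Integrable (fun t : AddCircle (1 : ℝ) =>
          2 * ∑ n ∈ Finset.range m, (fourier ((n : ℤ) + 1) t).re) σ := fun m =>
        (integrable_finsetSum _ fun n _ => hint n).const_mul 2
      have hadd : ∀ m : ℕ, Integrable (fun t : AddCircle (1 : ℝ) =>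
          1 + 2 * ∑ n ∈ Finset.range m, (fourier ((n : ℤ) + 1) t).re) σ := fun m =>
        (integrable_const 1).add (hsum m)
      rw [integral_finsetSum _ fun m _ => hadd m] at hpos
      refine hpos.trans_eq (Finset.sum_congr rfl fun m _ => ?_)
      rw [integral_add (integrable_const 1) (hsum m), integral_const_mul,
        integral_finsetSum _ fun n _ => hint n]
      simp only [abs_of_nonpos (hle _), Finset.sum_neg_distrib]
      simp
  exact ⟨summable_of_sum_range_le (fun _ => abs_nonneg _) hbound,
    Real.tsum_le_of_sum_range_le (fun _ => abs_nonneg _) hbound⟩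
end

section
/- Let σ be a symmetric probability measure on the circle 𝕋 = ℝ/ℤ such that σ̂(n) = ∫ cos(2πnt) dσ(t) ≤ 0 for every n ≥ 1. Then σ is equivalent to the Lebesgue (Haar) probability measure m on 𝕋, i.e. σ ≪ m and m ≪ σ. -/
open MeasureTheory

namespace AddCircle

variable {T : ℝ}

lemma norm_fourier_apply (n : ℤ) (t : AddCircle T) : ‖fourier n t‖ = 1 :=
  Circle.norm_coe _

lemma re_fourier_le_one (n : ℤ) (t : AddCircle T) : (fourier n t).re ≤ 1 :=
  (Complex.re_le_norm _).trans (norm_fourier_apply n t).le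

variable [hT : Fact (0 < T)]

lemma integrable_fourier (μ : Measure (AddCircle T)) [IsFiniteMeasure μ] (n : ℤ) :
    Integrable (fun t => fourier n t) μ :=
  (map_continuous (fourier n)).integrable_of_hasCompactSupport
    (HasCompactSupport.of_compactSpace _)

/-- Finite measures on the circle are determined by their Fourier coefficients. -/
lemma measure_ext_of_integral_fourier {μ ν : Measure (AddCircle T)} [IsFiniteMeasure μ]
    [IsFiniteMeasure ν] (h : ∀ n : ℤ, ∫ t, fourier n t ∂μ = ∫ t, fourier n t ∂ν) : μ = ν := by
  refine ext_of_forall_mem_subalgebra_integral_eq_of_polish (𝕜 := ℂ)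
    (A := (fourierSubalgebra (T := T)).comap
      (BoundedContinuousFunction.toContinuousMapStarₐ ℂ)) ?_ ?_
  · intro x y hxy
    obtain ⟨_, ⟨f, hf, rfl⟩, hfxy⟩ := fourierSubalgebra_separatesPoints hxy
    exact ⟨f, ⟨f, ⟨BoundedContinuousFunction.mkOfCompact f, hf, rfl⟩, rfl⟩, hfxy⟩
  · intro g hg
    have hg' : (g : C(AddCircle T, ℂ)) ∈ Submodule.span ℂ (Set.range (fourier (T := T))) := by
      rw [← fourierSubalgebra_coe]
      exact hg
    have hint (f : C(AddCircle T, ℂ)) (ρ : Measure (AddCircle T)) [IsFiniteMeasure ρ] :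
        Integrable f ρ :=
      (map_continuous f).integrable_of_hasCompactSupport (HasCompactSupport.of_compactSpace _)
    suffices H : ∀ f ∈ Submodule.span ℂ (Set.range (fourier (T := T))),
        ∫ t, f t ∂μ = ∫ t, f t ∂ν from H _ hg'
    intro f hf
    induction hf using Submodule.span_induction with
    | mem f hf => obtain ⟨n, rfl⟩ := hf; exact h n
    | zero => simp
    | add f₁ f₂ _ _ h₁ h₂ =>
      simp only [ContinuousMap.add_apply]
      rw [integral_add (hint f₁ μ) (hint f₂ μ), integral_add (hint f₁ ν) (hint f₂ ν), h₁, h₂]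
    | smul c f _ hf =>
      simp only [ContinuousMap.smul_apply]
      rw [integral_smul, integral_smul, hf]

lemma fourier_eq_one_iff {n : ℤ} {t : AddCircle T} : fourier n t = 1 ↔ n • t = 0 := by
  rw [← (injective_toCircle hT.out.ne').eq_iff, toCircle_zero]
  exact Circle.coe_eq_one

instance nontrivial : Nontrivial (AddCircle T) := by
  refine ⟨0 + ((T / 2 / (1 : ℤ) : ℝ) : AddCircle T), 0, fun h => ?_⟩
  have h1 := fourier_add_half_inv_index one_ne_zero hT.out (0 : AddCircle T)
  rw [h, fourier_eval_zero] at h1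
  norm_num at h1

lemma ae_re_fourier_ne_one {n : ℤ} (hn : n ≠ 0) :
    ∀ᵐ t ∂(haarAddCircle (T := T)), (fourier n t).re ≠ 1 := by
  have hfin : {t : AddCircle T | n • t = 0}.Finite :=
    finite_torsion_of_isSMulRegular_int _ n (.of_right_eq_zero_of_smul fun _ ↦ by simp [hn])
  refine measure_mono_null (fun t ht ↦ ?_) (hfin.measure_zero _)
  have hre : (fourier n t).re = 1 := by simpa using ht
  refine fourier_eq_one_iff.1 (Complex.ext (by simpa using hre) ?_)
  have := Complex.sq_norm (fourier n t)
  rw [norm_fourier_apply, Complex.normSq_apply, hre] at this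
  simp only [Complex.one_im]
  nlinarith

/-- Positive definiteness of the cosine coefficients. -/
lemma sum_sum_integral_re_fourier_sub_nonneg (μ : Measure (AddCircle T)) [IsFiniteMeasure μ]
    (A : Finset ℤ) : 0 ≤ ∑ j ∈ A, ∑ k ∈ A, ∫ t, (fourier (j - k) t).re ∂μ := by
  have hint (n : ℤ) : Integrable (fun t => (fourier n t).re) μ := (integrable_fourier μ n).re
  simp_rw [← integral_finsetSum A fun k _ => hint (_ - k)]
  rw [← integral_finsetSum A fun j _ => integrable_finsetSum A fun k _ => hint (j - k)]
  refine integral_nonneg fun t => ?_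
  have key : ∑ j ∈ A, ∑ k ∈ A, (fourier (j - k) t).re =
      Complex.normSq (∑ j ∈ A, fourier j t) := by
    rw [← Complex.ofReal_re (Complex.normSq _), Complex.normSq_eq_conj_mul_self, mul_comm,
      map_sum, Finset.sum_mul_sum, Complex.re_sum]
    refine Finset.sum_congr rfl fun j _ => ?_
    rw [Complex.re_sum]
    refine Finset.sum_congr rfl fun k _ => ?_
    rw [sub_eq_add_neg, fourier_add, fourier_neg]
  simp only [Pi.zero_apply]
  rw [key]
  exact Complex.normSq_nonneg _

end AddCircle

/-- A positive definite sequence that is nonpositive off `0` has nonnegative total mass. -/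
lemma sum_nonneg_of_posDef_of_nonpos {r : ℤ → ℝ}
    (hpos : ∀ A : Finset ℤ, 0 ≤ ∑ j ∈ A, ∑ k ∈ A, r (j - k))
    (hneg : ∀ n ≠ 0, r n ≤ 0) {F : Finset ℤ} (hF : 0 ∈ F) : 0 ≤ ∑ n ∈ F, r n := by
  by_contra! hS
  set S := ∑ n ∈ F, r n with hSdef
  obtain ⟨M, hM⟩ : ∃ M : ℕ, ∀ n ∈ F, n.natAbs ≤ M :=
    ⟨F.sup Int.natAbs, fun n hn => Finset.le_sup (f := Int.natAbs) hn⟩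
  have hr0 : 0 ≤ r 0 := by simpa using hpos {0}
  have hle {G H : Finset ℤ} (hGH : G ⊆ H) (hG : 0 ∈ G) : ∑ n ∈ H, r n ≤ ∑ n ∈ G, r n := by
    rw [← Finset.sum_sdiff hGH]
    have : ∑ n ∈ H \ G, r n ≤ 0 := Finset.sum_nonpos fun n hn => hneg n (by
      rintro rfl
      exact (Finset.mem_sdiff.1 hn).2 hG)
    linarith
  have hbound (L : ℕ) : 0 ≤ L * S + 2 * M * r 0 := by
    set A := Finset.Ico (-(M : ℤ)) (L + M) with hA
    set B := Finset.Ico (0 : ℤ) L with hB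
    have hBA : B ⊆ A := Finset.Ico_subset_Ico (by lia) (by lia)
    have hshift (j : ℤ) : ∑ k ∈ A, r (j - k) = ∑ n ∈ A.image (fun k => j - k), r n := by
      rw [Finset.sum_image fun a _ b _ h => by simpa using h]
    have hbulk : ∀ j ∈ B, ∑ k ∈ A, r (j - k) ≤ S := fun j hj => by
      rw [hshift]
      refine hle (fun n hn => Finset.mem_image.2 ⟨j - n, ?_, by ring⟩) hF
      have := hM n hn
      simp only [hA, hB, Finset.mem_Ico] at hj ⊢
      lia
    have hedge : ∀ j ∈ A \ B, ∑ k ∈ A, r (j - k) ≤ r 0 := fun j hj => by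
      rw [hshift]
      refine (hle (G := {0}) ?_ (by simp)).trans (by simp)
      simp only [Finset.singleton_subset_iff, Finset.mem_image]
      exact ⟨j, (Finset.mem_sdiff.1 hj).1, by ring⟩
    have hcard : (A \ B).card = 2 * M := by
      rw [Finset.card_sdiff_of_subset hBA, hA, hB, Int.card_Ico, Int.card_Ico]
      lia
    have h1 := Finset.sum_le_card_nsmul B _ S hbulk
    have h2 := Finset.sum_le_card_nsmul (A \ B) _ (r 0) hedge
    have h3 := hpos A
    rw [← Finset.sum_sdiff hBA] at h3
    rw [hcard, nsmul_eq_mul] at h2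
    rw [hB, Int.card_Ico, nsmul_eq_mul] at h1
    simp only [sub_zero, Int.toNat_natCast] at h1
    push_cast at h2
    linarith
  obtain ⟨L, hL⟩ := exists_nat_gt (2 * M * r 0 / -S)
  rw [div_lt_iff₀ (by linarith)] at hL
  linarith [hbound L]

lemma summable_of_posDef_of_nonpos {r : ℤ → ℝ}
    (hpos : ∀ A : Finset ℤ, 0 ≤ ∑ j ∈ A, ∑ k ∈ A, r (j - k))
    (hneg : ∀ n ≠ 0, r n ≤ 0) : Summable r := by
  have hsum : Summable fun n => -(r n - Pi.single (M := fun _ => ℝ) 0 (r 0) n) := by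
    refine summable_of_sum_le (c := r 0) (fun n => ?_) fun F => ?_
    · rcases eq_or_ne n 0 with rfl | hn
      · simp
      · simpa [hn] using hneg n hn
    · have hr0 : 0 ≤ r 0 := by simpa using hpos {0}
      have h := sum_nonneg_of_posDef_of_nonpos hpos hneg (Finset.mem_insert_self 0 F)
      by_cases h0 : (0 : ℤ) ∈ F
      · rw [Finset.insert_eq_of_mem h0] at h
        rw [Finset.sum_neg_distrib, Finset.sum_sub_distrib, Finset.sum_pi_single']
        simp only [h0, if_true]
        linarith
      · rw [Finset.sum_insert h0] at h
        rw [Finset.sum_neg_distrib, Finset.sum_sub_distrib, Finset.sum_pi_single']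
        simp only [h0, if_false]
        linarith
  have := hsum.neg.add (hasSum_pi_single (0 : ℤ) (r 0)).summable
  simpa using this

namespace AddCircle

variable {T : ℝ} [hT : Fact (0 < T)]

lemma integral_fourier_eq_ofReal_of_symm {μ : Measure (AddCircle T)} [IsFiniteMeasure μ]
    (hsymm : μ.map (fun t => -t) = μ) (n : ℤ) :
    ∫ t, fourier n t ∂μ = ((∫ t, (fourier n t).re ∂μ : ℝ) : ℂ) := by
  have hconj : ∫ t, fourier n t ∂μ = (starRingEnd ℂ) (∫ t, fourier n t ∂μ) := by
    rw [← integral_conj]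
    conv_lhs => rw [← hsymm]
    rw [integral_map (by fun_prop) (map_continuous (fourier n)).aestronglyMeasurable]
    refine integral_congr_ae (.of_forall fun t => ?_)
    change fourier n (-t) = (starRingEnd ℂ) (fourier n t)
    rw [← fourier_neg]
    simp only [fourier_apply, smul_neg, neg_smul]
  rw [← (Complex.conj_eq_iff_re.1 hconj.symm)]
  congr 1
  exact (integral_re (integrable_fourier μ n)).symm

/-- The Fourier coefficients of an absolutely summable cosine series with even coefficients `r`
are `r`. -/
lemma integral_fourier_mul_tsum {r : ℤ → ℝ} (hr : Summable r) (heven : ∀ n, r (-n) = r n) (m : ℤ) :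
    ∫ t, ((∑' n, r n * (fourier n t).re : ℝ) : ℂ) * fourier m t ∂(haarAddCircle (T := T)) =
      r m := by
  have hsum (t : AddCircle T) : Summable fun n => (r n : ℂ) * fourier n t :=
    Summable.of_norm (by simpa only [norm_mul, norm_fourier_apply, Complex.norm_real, mul_one,
      Real.norm_eq_abs] using hr.abs)
  have hdens (t : AddCircle T) :
      ((∑' n, r n * (fourier n t).re : ℝ) : ℂ) = ∑' n, (r n : ℂ) * fourier n t := by
    have hconj : (starRingEnd ℂ) (∑' n, (r n : ℂ) * fourier n t) =
        ∑' n, (r n : ℂ) * fourier n t := by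
      rw [Complex.conj_tsum, ← (Equiv.neg ℤ).tsum_eq]
      refine tsum_congr fun n => ?_
      simp [heven]
    rw [← Complex.conj_eq_iff_re.1 hconj, Complex.re_tsum (hsum t)]
    simp
  have hortho (n : ℤ) : ∫ t, (r n : ℂ) * fourier n t * fourier m t ∂(haarAddCircle (T := T)) =
      if n = -m then (r n : ℂ) else 0 := by
    have h := congrFun (fourierCoeff_fourier (T := T) n) (-m)
    simp only [fourierCoeff, neg_neg, smul_eq_mul] at h
    simp_rw [mul_assoc, mul_comm (fourier n _) (fourier m _)]
    rw [integral_const_mul, h]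
    by_cases hnm : n = -m
    · simp [hnm]
    · simp [hnm, Ne.symm hnm]
  simp_rw [hdens, ← tsum_mul_right]
  rw [← integral_tsum_of_summable_integral_norm]
  · simp_rw [hortho]
    rw [tsum_ite_eq]
    simp [heven]
  · intro n
    have hc : Continuous fun t : AddCircle T => (r n : ℂ) * fourier n t * fourier m t := by
      fun_prop
    exact hc.integrable_of_hasCompactSupport (HasCompactSupport.of_compactSpace _)
  · simpa only [norm_mul, norm_fourier_apply, Complex.norm_real, mul_one, integral_const,
      probReal_univ, one_smul, Real.norm_eq_abs] using hr.abs

lemma mutually_absolutelyContinuous_haarAddCircle {μ : Measure (AddCircle T)}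
    [IsProbabilityMeasure μ] (hsymm : μ.map (fun t => -t) = μ)
    (hneg : ∀ n : ℕ, 1 ≤ n → (∫ t, (fourier (n : ℤ) t).re ∂μ) ≤ 0) :
    μ ≪ haarAddCircle ∧ haarAddCircle ≪ μ := by
  set r : ℤ → ℝ := fun n => ∫ t, (fourier n t).re ∂μ with hrdef
  have hr0 : r 0 = 1 := by simp [hrdef]
  have heven (n : ℤ) : r (-n) = r n := by simp [hrdef]
  have hr_nonpos : ∀ n ≠ 0, r n ≤ 0 := by
    intro n hn
    obtain ⟨k, rfl | rfl⟩ := n.eq_nat_or_neg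
    · exact hneg k (by lia)
    · rw [heven]
      exact hneg k (by lia)
  have hpos := sum_sum_integral_re_fourier_sub_nonneg μ
  have hr : Summable r := summable_of_posDef_of_nonpos hpos hr_nonpos
  have htotal : 0 ≤ ∑' n, r n := ge_of_tendsto hr.hasSum
    ((Filter.eventually_ge_atTop {0}).mono fun F hF =>
      sum_nonneg_of_posDef_of_nonpos hpos hr_nonpos (hF (Finset.mem_singleton_self 0)))
  have habs (n : ℤ) (t : AddCircle T) : |(fourier n t).re| ≤ 1 :=
    (Complex.abs_re_le_norm _).trans (norm_fourier_apply n t).le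
  have hbound (n : ℤ) (t : AddCircle T) : ‖r n * (fourier n t).re‖ ≤ |r n| := by
    rw [norm_mul, Real.norm_eq_abs, Real.norm_eq_abs]
    exact mul_le_of_le_one_right (abs_nonneg _) (habs n t)
  set g : AddCircle T → ℝ := fun t => ∑' n, r n * (fourier n t).re with hgdef
  have hg_cont : Continuous g :=
    continuous_tsum (fun n => by fun_prop) hr.abs hbound
  have hterm (n : ℤ) (t : AddCircle T) : 0 ≤ r n * (fourier n t).re - r n := by
    rcases eq_or_ne n 0 with rfl | hn
    · simp
    · nlinarith [hr_nonpos n hn, re_fourier_le_one n t]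
  have hg_ge (n : ℤ) (t : AddCircle T) : r n * (fourier n t).re - r n ≤ g t := by
    have hs : Summable fun n => r n * (fourier n t).re :=
      Summable.of_norm_bounded hr.abs fun n => hbound n t
    have h := (hs.sub hr).le_tsum n fun k _ => hterm k t
    rw [hs.tsum_sub hr] at h
    simp only [hgdef]
    linarith
  have hg_nonneg (t : AddCircle T) : 0 ≤ g t := (hterm 0 t).trans (hg_ge 0 t)
  have hg_ne : ∀ᵐ t ∂(haarAddCircle (T := T)), g t ≠ 0 := by
    by_cases h : ∀ n ≠ 0, r n = 0
    · refine .of_forall fun t => ?_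
      have : g t = 1 := by
        simp only [hgdef]
        rw [tsum_eq_single 0 fun n hn => by simp [h n hn]]
        simp [hr0]
      simp [this]
    · push Not at h
      obtain ⟨n, hn, hrn⟩ := h
      filter_upwards [ae_re_fourier_ne_one hn] with t ht hgt
      have h1 := hg_ge n t
      have h2 := lt_of_le_of_ne (hr_nonpos n hn) hrn
      have h3 := lt_of_le_of_ne (re_fourier_le_one n t) ht
      nlinarith
  have hg_int : Integrable g (haarAddCircle (T := T)) :=
    hg_cont.integrable_of_hasCompactSupport (HasCompactSupport.of_compactSpace _)
  have hmeas : Measurable fun t => ENNReal.ofReal (g t) := hg_cont.measurable.ennreal_ofReal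
  have : IsFiniteMeasure ((haarAddCircle (T := T)).withDensity fun t => ENNReal.ofReal (g t)) :=
    isFiniteMeasure_withDensity_ofReal hg_int.2
  have hμ : μ = (haarAddCircle (T := T)).withDensity fun t => ENNReal.ofReal (g t) := by
    refine measure_ext_of_integral_fourier fun m => ?_
    rw [integral_fourier_eq_ofReal_of_symm hsymm, integral_withDensity_eq_integral_toReal_smul
      hmeas (.of_forall fun _ => ENNReal.ofReal_lt_top)]
    simp_rw [ENNReal.toReal_ofReal (hg_nonneg _), Complex.real_smul]
    exact (integral_fourier_mul_tsum hr heven m).symm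
  rw [hμ]
  refine ⟨withDensity_absolutelyContinuous _ _,
    withDensity_absolutelyContinuous' hmeas.aemeasurable ?_⟩
  filter_upwards [hg_ne] with t ht
  simpa using lt_of_le_of_ne (hg_nonneg t) ht.symm

end AddCircle

theorem stmt_14 (σ : Measure (AddCircle (1 : ℝ))) [IsProbabilityMeasure σ]
    (hsymm : σ.map (fun t => -t) = σ)
    (hneg : ∀ n : ℕ, 1 ≤ n → (∫ t, (fourier (n : ℤ) t).re ∂σ) ≤ 0) :
    σ ≪ (volume : Measure (AddCircle (1 : ℝ))) ∧
    (volume : Measure (AddCircle (1 : ℝ))) ≪ σ := by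
  rw [AddCircle.volume_eq_smul_haarAddCircle, ENNReal.ofReal_one, one_smul]
  exact AddCircle.mutually_absolutelyContinuous_haarAddCircle hsymm hneg
end

section
/- Let (X, 𝒳, μ, T) be a measure preserving system and let f : X → [0,1] be a measurable function. Then there exist a measure preserving system (Y, 𝒴, ν, S) with S invertible and a set A ∈ 𝒴 such that for every ℓ ∈ ℕ and all pairwise distinct non-negative integers n₁, …, n_ℓ one has ν(S^{−n₁}A ∩ ⋯ ∩ S^{−n_ℓ}A) = ∫ (f∘T^{n₁}) · … · (f∘T^{n_ℓ}) dμ. Moreover, if the system (X, 𝒳, μ, T) is mixing then the system (Y, 𝒴, ν, S) is mixing. -/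
open MeasureTheory Filter Topology

/-- The mixing property of a transformation `S` of a measure space. -/
def IsMixing {Y : Type*} [MeasurableSpace Y] (S : Y → Y) (ν : Measure Y) : Prop :=
  ∀ B C : Set Y, MeasurableSet B → MeasurableSet C →
    Tendsto (fun n : ℕ => ν (B ∩ S^[n] ⁻¹' C)) atTop (𝓝 (ν B * ν C))

/-- Convergence of dominated measures on a generating π-system implies setwise convergence. -/
lemma tendsto_measure_of_piSystem {α : Type*} [m : MeasurableSpace α] {κ : ℕ → Measure α}
    {η ρ : Measure α} [IsFiniteMeasure ρ] [IsFiniteMeasure η] (hle : ∀ n, κ n ≤ ρ)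
    (huniv : Tendsto (fun n => κ n Set.univ) atTop (𝓝 (η Set.univ)))
    {P : Set (Set α)} (hgen : m = MeasurableSpace.generateFrom P) (hpi : IsPiSystem P)
    (hP : ∀ D ∈ P, Tendsto (fun n => κ n D) atTop (𝓝 (η D))) {D : Set α} (hD : MeasurableSet D) :
    Tendsto (fun n => κ n D) atTop (𝓝 (η D)) := by
  have hfin : ∀ n, IsFiniteMeasure (κ n) := fun n => isFiniteMeasure_of_le ρ (hle n)
  induction D, hD using MeasurableSpace.induction_on_inter hgen hpi with
  | empty => simp
  | basic t ht => exact hP t ht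
  | compl t ht ih =>
    simp_rw [measure_compl ht (measure_ne_top _ _)]
    exact ENNReal.Tendsto.sub huniv ih (Or.inl (measure_ne_top _ _))
  | iUnion g hd hg ih =>
    simp_rw [measure_iUnion hd hg, ← lintegral_count]
    refine tendsto_lintegral_of_dominated_convergence (fun i => ρ (g i))
      (fun n => measurable_of_countable _) (fun n => ae_of_all _ fun i => hle n _) ?_
      (ae_of_all _ ih)
    rw [lintegral_count, ← measure_iUnion hd hg]
    exact measure_ne_top _ _

/-- It suffices to check mixing on a generating π-system. -/
lemma isMixing_of_piSystem {Y : Type*} [m : MeasurableSpace Y] {ν : Measure Y}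
    [IsProbabilityMeasure ν] {S : Y → Y} (hS : MeasurePreserving S ν ν)
    {P : Set (Set Y)} (hgen : m = MeasurableSpace.generateFrom P) (hpi : IsPiSystem P)
    (hP : ∀ B ∈ P, ∀ C ∈ P,
      Tendsto (fun n : ℕ => ν (B ∩ S^[n] ⁻¹' C)) atTop (𝓝 (ν B * ν C))) :
    IsMixing S ν := by
  have hmeas : ∀ B ∈ P, MeasurableSet B := fun B hB =>
    hgen ▸ MeasurableSpace.measurableSet_generateFrom hB
  have hpre : ∀ n {C : Set Y}, MeasurableSet C → MeasurableSet (S^[n] ⁻¹' C) :=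
    fun n C hC => (hS.iterate n).measurable hC
  have right : ∀ B ∈ P, ∀ C, MeasurableSet C →
      Tendsto (fun n : ℕ => ν (B ∩ S^[n] ⁻¹' C)) atTop (𝓝 (ν B * ν C)) := by
    intro B hB C hC
    have key : ∀ n {D : Set Y}, MeasurableSet D →
        (ν.restrict B).map S^[n] D = ν (B ∩ S^[n] ⁻¹' D) := fun n D hD => by
      rw [Measure.map_apply (hS.iterate n).measurable hD, Measure.restrict_apply (hpre n hD),
        Set.inter_comm]
    have h := tendsto_measure_of_piSystem (κ := fun n => (ν.restrict B).map S^[n])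
      (η := (ν B).toNNReal • ν) (ρ := ν) (fun n => ?_) ?_ hgen hpi (fun D hD => ?_) hC
    · simpa [key _ hC, ENNReal.smul_def] using h
    · calc (ν.restrict B).map S^[n] ≤ ν.map S^[n] :=
            Measure.map_mono Measure.restrict_le_self (hS.iterate n).measurable
        _ = ν := (hS.iterate n).map_eq
    · simp [key _ MeasurableSet.univ, ENNReal.smul_def]
    · simpa [key _ (hmeas D hD), ENNReal.smul_def] using hP B hB D hD
  intro B C hB hC
  have key : ∀ n {D : Set Y}, MeasurableSet D →
      ν.restrict (S^[n] ⁻¹' C) D = ν (D ∩ S^[n] ⁻¹' C) := fun n D hD =>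
    Measure.restrict_apply hD
  have h := tendsto_measure_of_piSystem (κ := fun n => ν.restrict (S^[n] ⁻¹' C))
      (η := (ν C).toNNReal • ν) (ρ := ν) (fun n => Measure.restrict_le_self) ?_ hgen hpi
      (fun D hD => ?_) hB
  · simpa [key _ hB, ENNReal.smul_def, mul_comm] using h
  · simp [(hS.iterate _).measure_preimage hC.nullMeasurableSet, ENNReal.smul_def]
  · simpa [key _ (hmeas D hD), ENNReal.smul_def, mul_comm] using right D hD C hC

lemma IsMixing.prodMap {X W : Type*} [MeasurableSpace X] [MeasurableSpace W] {μ : Measure X}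
    {p : Measure W} [IsProbabilityMeasure μ] [IsProbabilityMeasure p] {T : X → X} {U : W → W}
    (hT : MeasurePreserving T μ μ) (hU : MeasurePreserving U p p)
    (hTm : IsMixing T μ) (hUm : IsMixing U p) : IsMixing (Prod.map T U) (μ.prod p) := by
  refine isMixing_of_piSystem (hT.prod hU) generateFrom_prod.symm isPiSystem_prod ?_
  rintro _ ⟨B, hB, B', hB', rfl⟩ _ ⟨C, hC, C', hC', rfl⟩
  simp only [Prod.map_iterate, Set.preimage_prod_map_prod, Set.prod_inter_prod, Measure.prod_prod]
  rw [mul_mul_mul_comm]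
  exact ENNReal.Tendsto.mul (hTm B C hB hC) (Or.inr (by finiteness)) (hUm B' C' hB' hC')
    (Or.inr (by finiteness))

section Shift

variable {α : Type*}

/-- The one-sided shift. -/
def natShift (u : ℕ → α) : ℕ → α := fun j => u (j + 1)

lemma natShift_iterate (n : ℕ) (u : ℕ → α) (j : ℕ) : natShift^[n] u j = u (j + n) := by
  induction n generalizing u with
  | zero => rfl
  | succ n ih => rw [Function.iterate_succ_apply, ih, natShift, Nat.add_assoc]

lemma preimage_natShift_iterate_pi (n : ℕ) (s : Finset ℕ) (t : ℕ → Set α) :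
    natShift^[n] ⁻¹' Set.pi s t =
      Set.pi (s.map (addRightEmbedding n)) (fun j => t (j - n)) := by
  ext u
  simp [Set.mem_pi, natShift_iterate]

variable [MeasurableSpace α] (p : Measure α) [IsProbabilityMeasure p]

lemma measurePreserving_natShift :
    MeasurePreserving natShift (Measure.infinitePi fun _ : ℕ => p)
      (Measure.infinitePi fun _ : ℕ => p) := by
  have hm : Measurable (natShift : (ℕ → α) → ℕ → α) :=
    measurable_pi_lambda _ fun j => measurable_pi_apply (j + 1)
  refine ⟨hm, Measure.eq_infinitePi _ fun s t ht => ?_⟩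
  rw [Measure.map_apply hm (.pi s.countable_toSet fun i _ => ht i)]
  have := preimage_natShift_iterate_pi 1 s t
  rw [Function.iterate_one] at this
  rw [this, Measure.infinitePi_pi _ fun i _ => ht _]
  simp

lemma isMixing_natShift : IsMixing natShift (Measure.infinitePi fun _ : ℕ => p) := by
  refine isMixing_of_piSystem (measurePreserving_natShift p) generateFrom_squareCylinders.symm
    (isPiSystem_squareCylinders (fun _ => MeasurableSpace.isPiSystem_measurableSet)
      fun _ => MeasurableSet.univ) ?_
  rintro _ ⟨s, (t : ℕ → Set α), ht, rfl⟩ _ ⟨s', (t' : ℕ → Set α), ht', rfl⟩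
  replace ht : ∀ i, MeasurableSet (t i) := fun i => ht i trivial
  replace ht' : ∀ i, MeasurableSet (t' i) := fun i => ht' i trivial
  refine tendsto_const_nhds.congr' ?_
  filter_upwards [eventually_gt_atTop (s.sup id)] with n hn
  have hlt : ∀ i ∈ s, i < n := fun i hi => (Finset.le_sup (f := id) hi).trans_lt hn
  have hset : Set.pi s t ∩ natShift^[n] ⁻¹' Set.pi s' t' =
      Set.pi (s ∪ s'.map (addRightEmbedding n) : Finset ℕ)
        (fun j => if j < n then t j else t' (j - n)) := by
    rw [preimage_natShift_iterate_pi, Finset.coe_union, Set.union_pi]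
    congr 1
    · exact Set.pi_congr rfl fun i hi => by simp [hlt i hi]
    · exact Set.pi_congr rfl fun i hi => by
        obtain ⟨j, -, rfl⟩ := by simpa using hi
        simp
  have hdisj : Disjoint s (s'.map (addRightEmbedding n)) := by
    rw [Finset.disjoint_left]
    intro i hi hi'
    obtain ⟨j, -, rfl⟩ := by simpa using hi'
    have := hlt _ hi
    omega
  rw [hset, Measure.infinitePi_pi _ fun i _ => ht i, Measure.infinitePi_pi _ fun i _ => ht' i,
    Measure.infinitePi_pi, Finset.prod_union hdisj]
  · congr 1
    · exact Finset.prod_congr rfl fun i hi => by simp [hlt i hi]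
    · simp
  · intro i _
    split_ifs
    exacts [ht _, ht' _]

end Shift

section FiniteDependence

lemma DependsOn.isClopen {E : Set (ℤ → Bool)} {s : Finset ℤ}
    (hE : DependsOn (fun y => y ∈ E) (s : Set ℤ)) : IsClopen E := by
  have : E = s.restrict ⁻¹' (s.restrict '' E) := by
    refine (Set.subset_preimage_image _ _).antisymm ?_
    rintro y ⟨y', hy', h⟩
    exact (hE fun i hi => congr_fun h ⟨i, hi⟩).mp hy'
  rw [this]
  exact (isClopen_discrete _).preimage (by fun_prop)

/-- The events on `ℤ → Bool` which depend on finitely many coordinates. -/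
def finitelyDependent : Set (Set (ℤ → Bool)) :=
  {E | ∃ s : Finset ℤ, DependsOn (fun y => y ∈ E) (s : Set ℤ)}

lemma isPiSystem_finitelyDependent : IsPiSystem finitelyDependent := by
  rintro E ⟨s, hs⟩ F ⟨t, ht⟩ -
  refine ⟨s ∪ t, fun y y' h => ?_⟩
  have h₁ := hs fun i hi => h i (by simp [Finset.mem_coe.1 hi])
  have h₂ := ht fun i hi => h i (by simp [Finset.mem_coe.1 hi])
  simp only [Set.mem_inter_iff, h₁, h₂]

lemma generateFrom_finitelyDependent :
    (MeasurableSpace.pi : MeasurableSpace (ℤ → Bool)) =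
      MeasurableSpace.generateFrom finitelyDependent := by
  refine le_antisymm ?_ (MeasurableSpace.generateFrom_le ?_)
  · rw [← generateFrom_measurableCylinders]
    refine MeasurableSpace.generateFrom_mono fun E hE => ?_
    obtain ⟨s, D, -, rfl⟩ := (mem_measurableCylinders E).1 hE
    refine ⟨s, fun y y' h => ?_⟩
    have : s.restrict y = s.restrict y' := funext fun i => h i i.2
    simp [cylinder, this]
  · rintro E ⟨s, hs⟩
    exact hs.isClopen.isOpen.measurableSet

lemma Finset.exists_nat_neg_le (s : Finset ℤ) : ∃ k : ℕ, ∀ i ∈ s, -(k : ℤ) ≤ i :=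
  ⟨s.sup Int.natAbs, fun i hi => by have := Finset.le_sup (f := Int.natAbs) hi; omega⟩

/-- The two-sided shift. -/
def intShift (y : ℤ → Bool) : ℤ → Bool := fun i => y (i + 1)

lemma intShift_iterate (n : ℕ) (y : ℤ → Bool) (i : ℤ) : intShift^[n] y i = y (i + n) := by
  induction n generalizing y with
  | zero => simp
  | succ n ih => rw [Function.iterate_succ_apply, ih, intShift]; push_cast; congr 1; ring

lemma measurable_intShift : Measurable intShift :=
  measurable_pi_lambda _ fun i => measurable_pi_apply (i + 1)

lemma DependsOn.preimage_intShift_iterate {E : Set (ℤ → Bool)} {s : Finset ℤ}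
    (hE : DependsOn (fun y => y ∈ E) (s : Set ℤ)) (n : ℕ) :
    DependsOn (fun y => y ∈ intShift^[n] ⁻¹' E)
      (s.map (addRightEmbedding (n : ℤ)) : Finset ℤ) := by
  refine fun y y' h => hE fun i hi => ?_
  rw [intShift_iterate, intShift_iterate]
  exact h _ (by simpa using hi)

end FiniteDependence

section Coding

variable {Z : Type*}

open scoped Classical in
/-- The itinerary of a point through `A`, recentred at time `k` and frozen at negative times. -/
noncomputable def coding (R : Z → Z) (A : Set Z) (k : ℕ) (z : Z) : ℤ → Bool :=
  fun i => decide (R^[(i + k).toNat] z ∈ A)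

lemma intShift_iterate_coding (R : Z → Z) (A : Set Z) (k n : ℕ) (z : Z) :
    intShift^[n] (coding R A k z) = coding R A (k + n) z := by
  funext i
  rw [intShift_iterate]
  simp only [coding]
  congr 4
  push_cast
  ring

lemma coding_iterate (R : Z → Z) (A : Set Z) (k n : ℕ) (z : Z) {i : ℤ} (hi : -(k : ℤ) ≤ i) :
    coding R A k (R^[n] z) i = coding R A (k + n) z i := by
  have : (i + (k + n : ℕ)).toNat = (i + k).toNat + n := by omega
  simp only [coding]
  rw [this, Function.iterate_add_apply]

lemma preimage_coding_add {R : Z → Z} {A : Set Z} {E : Set (ℤ → Bool)} {s : Finset ℤ}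
    (hE : DependsOn (fun y => y ∈ E) (s : Set ℤ)) {k : ℕ} (hk : ∀ i ∈ s, -(k : ℤ) ≤ i) (n : ℕ) :
    coding R A (k + n) ⁻¹' E = R^[n] ⁻¹' (coding R A k ⁻¹' E) := by
  ext z
  exact iff_of_eq (hE fun i hi => (coding_iterate R A k n z (hk i hi)).symm)

variable [MeasurableSpace Z] {m : Measure Z} [IsProbabilityMeasure m] {R : Z → Z} {A : Set Z}

lemma measurable_coding (hR : Measurable R) (hA : MeasurableSet A) (k : ℕ) :
    Measurable (coding R A k) :=
  measurable_pi_lambda _ fun i => measurable_to_bool <| by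
    convert! (hR.iterate (i + k).toNat) hA using 1
    ext z
    simp [coding]

/-- A measure on bi-infinite itineraries extending the law of the forward itinerary. -/
lemma exists_measure_coding (hR : MeasurePreserving R m m) (hA : MeasurableSet A) :
    ∃ ν : Measure (ℤ → Bool), IsProbabilityMeasure ν ∧
      ∀ (s : Finset ℤ) (E : Set (ℤ → Bool)), DependsOn (fun y => y ∈ E) (s : Set ℤ) →
        ∀ k : ℕ, (∀ i ∈ s, -(k : ℤ) ≤ i) → ν E = m (coding R A k ⁻¹' E) := by
  have hmeas := measurable_coding (R := R) hR.measurable hA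
  let κ : ℕ → ProbabilityMeasure (ℤ → Bool) := fun k =>
    ⟨m.map (coding R A k), Measure.isProbabilityMeasure_map (hmeas k).aemeasurable⟩
  let ν := ((hyperfilter ℕ).map κ).lim
  have hν : Tendsto κ (hyperfilter ℕ) (𝓝 ν) := Ultrafilter.le_nhds_lim _
  refine ⟨ν, inferInstance, fun s E hE k hk => ?_⟩
  have hlim := ProbabilityMeasure.tendsto_measure_of_isClopen_of_tendsto hν hE.isClopen
  have hlim' : Tendsto (fun i => (κ i : Measure (ℤ → Bool)) E) (hyperfilter ℕ)
      (𝓝 ((ν : Measure (ℤ → Bool)) E)) := by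
    simpa using ENNReal.tendsto_coe.2 hlim
  refine tendsto_nhds_unique hlim' (tendsto_const_nhds.congr' ?_)
  have hge : ∀ᶠ j in (hyperfilter ℕ : Filter ℕ), k ≤ j :=
    Nat.hyperfilter_le_atTop (eventually_ge_atTop k)
  filter_upwards [hge] with j hj
  obtain ⟨n, rfl⟩ := Nat.exists_eq_add_of_le hj
  have hEm : MeasurableSet E := hE.isClopen.isOpen.measurableSet
  change _ = m.map (coding R A (k + n)) E
  rw [Measure.map_apply (hmeas _) hEm, preimage_coding_add hE hk,
    (hR.iterate n).measure_preimage ((hmeas k) hEm).nullMeasurableSet]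

/-- A measurable set in a measure preserving system can be modelled by a set in an invertible
system, preserving correlations and mixing. -/
lemma exists_invertible_model (hR : MeasurePreserving R m m) (hA : MeasurableSet A) :
    ∃ ν : Measure (ℤ → Bool), IsProbabilityMeasure ν ∧ MeasurePreserving intShift ν ν ∧
      (∀ (ℓ : ℕ) (n : Fin ℓ → ℕ), ν (⋂ i, intShift^[n i] ⁻¹' ((fun y => y 0) ⁻¹' {true})) =
        m (⋂ i, R^[n i] ⁻¹' A)) ∧
      (IsMixing R m → IsMixing intShift ν) := by
  obtain ⟨ν, hprob, hν⟩ := exists_measure_coding hR hA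
  have hmeas := measurable_coding (R := R) hR.measurable hA
  have hshift : MeasurePreserving intShift ν ν := by
    refine ⟨measurable_intShift, ?_⟩
    have := Measure.isProbabilityMeasure_map (μ := ν) measurable_intShift.aemeasurable
    refine ext_of_generate_finite finitelyDependent generateFrom_finitelyDependent
      isPiSystem_finitelyDependent ?_ (by simp)
    rintro E ⟨s, hs⟩
    obtain ⟨k, hk⟩ := s.exists_nat_neg_le
    rw [Measure.map_apply measurable_intShift hs.isClopen.isOpen.measurableSet]
    have h := hν _ _ (hs.preimage_intShift_iterate 1) k (by
      simp only [Finset.mem_map, addRightEmbedding_apply]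
      rintro _ ⟨i, hi, rfl⟩
      have := hk i hi
      push_cast
      omega)
    rw [Function.iterate_one] at h
    rw [h, hν s E hs (k + 1) fun i hi => by have := hk i hi; push_cast; omega]
    congr 1
    ext z
    exact iff_of_eq (congrArg (· ∈ E) (intShift_iterate_coding R A k 1 z))
  refine ⟨ν, hprob, hshift, fun ℓ n => ?_, fun hmix => ?_⟩
  · rw [hν (Finset.univ.image fun i => (n i : ℤ)) _ ?_ 0 ?_]
    · congr 1
      ext z
      simp [intShift_iterate, coding]
    · intro y y' h
      simp only [Set.mem_iInter, Set.mem_preimage, Set.mem_singleton_iff, intShift_iterate]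
      exact forall_congr fun i => by rw [h (0 + n i) (by simp)]
    · simp
  · refine isMixing_of_piSystem hshift generateFrom_finitelyDependent
      isPiSystem_finitelyDependent ?_
    rintro E ⟨s, hs⟩ F ⟨t, ht⟩
    obtain ⟨k, hk⟩ := (s ∪ t).exists_nat_neg_le
    have hks : ∀ i ∈ s, -(k : ℤ) ≤ i := fun i hi => hk i (Finset.mem_union_left _ hi)
    have hkt : ∀ i ∈ t, -(k : ℤ) ≤ i := fun i hi => hk i (Finset.mem_union_right _ hi)
    rw [hν s E hs k hks, hν t F ht k hkt]
    refine (hmix _ _ (hmeas k hs.isClopen.isOpen.measurableSet)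
      (hmeas k ht.isClopen.isOpen.measurableSet)).congr fun n => ?_
    rw [hν (s ∪ t.map (addRightEmbedding (n : ℤ))) _ ?_ k ?_, Set.preimage_inter,
      ← preimage_coding_add ht hkt]
    · congr 2
      ext z
      simp only [Set.mem_preimage, intShift_iterate_coding]
    · intro y y' h
      have h₁ := hs fun i hi => h i (by simp [Finset.mem_coe.1 hi])
      have h₂ := ht.preimage_intShift_iterate n fun i hi => h i (by
        rw [Finset.coe_union]
        exact Or.inr hi)
      simp only [Set.mem_inter_iff, h₁, h₂]
    · simp only [Finset.mem_union, Finset.mem_map, addRightEmbedding_apply]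
      rintro _ (hi | ⟨i, hi, rfl⟩)
      · exact hks _ hi
      · have := hkt i hi
        omega

end Coding

/-- Correlations of the region under the graph of `F` in the product of `T` with a Bernoulli
shift. -/
lemma measure_iInter_subgraph {X : Type*} [MeasurableSpace X] {μ : Measure X}
    [IsProbabilityMeasure μ] {T : X → X} (hT : Measurable T) {F : X → unitInterval}
    (hF : Measurable F) {ℓ : ℕ} {n : Fin ℓ → ℕ} (hn : Function.Injective n) :
    (μ.prod (Measure.infinitePi fun _ : ℕ => (volume : Measure unitInterval))).real
        (⋂ i, (Prod.map T natShift)^[n i] ⁻¹' {z | z.2 0 ≤ F z.1}) =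
      ∫ x, ∏ i, (F (T^[n i] x) : ℝ) ∂μ := by
  have hset : (⋂ i, (Prod.map T natShift)^[n i] ⁻¹'
      {z : X × (ℕ → unitInterval) | z.2 0 ≤ F z.1}) =
      ⋂ i, {z | z.2 (n i) ≤ F (T^[n i] z.1)} := by
    ext z
    simp [Prod.map_iterate, natShift_iterate]
  have hmeas : MeasurableSet (⋂ i, {z : X × (ℕ → unitInterval) | z.2 (n i) ≤ F (T^[n i] z.1)}) :=
    .iInter fun i => measurableSet_le ((measurable_pi_apply _).comp measurable_snd)
      (hF.comp ((hT.iterate _).comp measurable_fst))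
  rw [hset, measureReal_def, Measure.prod_apply hmeas, integral_eq_lintegral_of_nonneg_ae]
  · congr 1
    refine lintegral_congr fun x => ?_
    have : Prod.mk x ⁻¹' (⋂ i, {z : X × (ℕ → unitInterval) | z.2 (n i) ≤ F (T^[n i] z.1)}) =
        Set.pi (Finset.univ.map ⟨n, hn⟩ : Finset ℕ) (fun j => Set.Iic (F (T^[j] x))) := by
      ext u
      simp [Set.mem_pi]
    rw [this, Measure.infinitePi_pi _ fun i _ => measurableSet_Iic,
      ENNReal.ofReal_prod_of_nonneg fun i _ => (F (T^[n i] x)).2.1]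
    simp [unitInterval.volume_Iic]
  · exact ae_of_all _ fun x => Finset.prod_nonneg fun i _ => (F (T^[n i] x)).2.1
  · exact (Finset.measurable_prod _ fun i _ =>
      measurable_subtype_coe.comp (hF.comp (hT.iterate _))).aestronglyMeasurable

theorem stmt_15 {X : Type*} [MeasurableSpace X] (μ : Measure X) [IsProbabilityMeasure μ]
    (T : X → X) (hTm : Measurable T) (hT : MeasurePreserving T μ μ)
    (f : X → ℝ) (hfm : Measurable f) (hf01 : ∀ x, f x ∈ Set.Icc (0 : ℝ) 1) :
    ∃ (Y : Type) (_ : MeasurableSpace Y) (ν : Measure Y) (S Sinv : Y → Y),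
      IsProbabilityMeasure ν ∧
      MeasurePreserving S ν ν ∧ MeasurePreserving Sinv ν ν ∧
      Function.LeftInverse Sinv S ∧ Function.RightInverse Sinv S ∧
      ∃ A : Set Y, MeasurableSet A ∧
        (∀ (ℓ : ℕ), 1 ≤ ℓ → ∀ n : Fin ℓ → ℕ, Function.Injective n →
          (ν (⋂ i, S^[n i] ⁻¹' A)).toReal = ∫ x, ∏ i, f (T^[n i] x) ∂μ) ∧
        -- if the original system is mixing then so is the new one
        ((∀ B C : Set X, MeasurableSet B → MeasurableSet C →
            Tendsto (fun n : ℕ => μ (B ∩ T^[n] ⁻¹' C)) atTop (𝓝 (μ B * μ C))) →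
          (∀ B C : Set Y, MeasurableSet B → MeasurableSet C →
            Tendsto (fun n : ℕ => ν (B ∩ S^[n] ⁻¹' C)) atTop (𝓝 (ν B * ν C)))) := by
  let F : X → unitInterval := fun x => ⟨f x, hf01 x⟩
  have hF : Measurable F := hfm.subtype_mk
  let p : Measure (ℕ → unitInterval) := Measure.infinitePi fun _ => volume
  have hp : MeasurePreserving natShift p p := measurePreserving_natShift _
  have hA : MeasurableSet {z : X × (ℕ → unitInterval) | z.2 0 ≤ F z.1} :=
    measurableSet_le ((measurable_pi_apply _).comp measurable_snd) (hF.comp measurable_fst)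
  obtain ⟨ν, hν, hS, hcorr, hmix⟩ := exists_invertible_model (hT.prod hp) hA
  let e : (ℤ → Bool) ≃ᵐ (ℤ → Bool) :=
    { toFun := intShift
      invFun := fun y i => y (i - 1)
      left_inv := fun y => by funext i; simp [intShift]
      right_inv := fun y => by funext i; simp [intShift]
      measurable_toFun := measurable_intShift
      measurable_invFun := measurable_pi_lambda _ fun i => measurable_pi_apply (i - 1) }
  have he : MeasurePreserving e ν ν := hS
  refine ⟨ℤ → Bool, inferInstance, ν, intShift, e.symm, hν, hS, he.symm, e.left_inv, e.right_inv,
    (fun y => y 0) ⁻¹' {true}, (measurable_pi_apply 0) (measurableSet_singleton true),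
    fun ℓ _ n hn => ?_, fun h => hmix (IsMixing.prodMap hT hp h (isMixing_natShift _))⟩
  rw [hcorr, ← measureReal_def]
  exact measure_iInter_subgraph hTm hF hn
end

section
/- Let σ be a symmetric probability measure on the circle 𝕋 = ℝ/ℤ and let m denote the Haar probability measure on 𝕋. Define T : 𝕋² → 𝕋² by T(x, y) = (x, y + x), let μ = σ × m, and let f(x, y) = (1 + cos(2πy))/2. Then T preserves μ, f takes values in [0,1], ∫ f dμ = 1/2, and for every n ≥ 0 one has ∫ f · (f∘Tⁿ) dμ − (∫ f dμ)² = (1/8)·σ̂(n), where σ̂(n) = ∫ cos(2πnt) dσ(t). -/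
open MeasureTheory Filter Topology

theorem AddCircle.integral_fourier_eq_zero {k : ℤ} (hk : k ≠ 0) :
    ∫ y : AddCircle (1 : ℝ), fourier k y = 0 :=
  integral_eq_zero_of_add_right_eq_neg (g := (((1 : ℝ) / 2 / k : ℝ) : AddCircle (1 : ℝ)))
    fun y => fourier_add_half_inv_index hk one_pos y

theorem Continuous.integrable_of_compactSpace {X E : Type*} [TopologicalSpace X] [CompactSpace X]
    [MeasurableSpace X] [OpensMeasurableSpace X] [NormedAddCommGroup E] {μ : Measure X}
    [IsFiniteMeasureOnCompacts μ] {g : X → E} (hg : Continuous g) : Integrable g μ :=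
  hg.integrable_of_hasCompactSupport (HasCompactSupport.of_compactSpace g)

theorem AddCircle.integral_re_mul_fourier_eq_zero {k : ℤ} (hk : k ≠ 0) (c : ℂ) :
    ∫ y : AddCircle (1 : ℝ), (fourier k y * c).re = 0 := by
  have h := integral_re (𝕜 := ℂ) (μ := (volume : Measure (AddCircle (1 : ℝ))))
    (f := fun y : AddCircle (1 : ℝ) => fourier k y * c)
    (Continuous.integrable_of_compactSpace (by fun_prop))
  rw [integral_mul_const, AddCircle.integral_fourier_eq_zero hk] at h
  simpa using h

theorem Complex.re_mul_re_mul_of_norm_eq_one {z : ℂ} (hz : ‖z‖ = 1) (w : ℂ) :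
    z.re * (z * w).re = ((z * z * w).re + w.re) / 2 := by
  have h : z.re * z.re + z.im * z.im = 1 := by
    rw [← Complex.normSq_apply, Complex.normSq_eq_norm_sq, hz, one_pow]
  simp only [Complex.mul_re, Complex.mul_im]
  linear_combination (w.re / 2) * h

theorem AddCircle.integral_shifted_cosine_product (s : AddCircle (1 : ℝ)) :
    ∫ y : AddCircle (1 : ℝ), (1 + (fourier (1 : ℤ) y).re) / 2
        * ((1 + (fourier (1 : ℤ) (y + s)).re) / 2)
      = 1 / 4 + 1 / 8 * (fourier (1 : ℤ) s).re := by
  set w : ℂ := fourier (1 : ℤ) s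
  have hprod (y : AddCircle (1 : ℝ)) : (1 + (fourier (1 : ℤ) y).re) / 2
        * ((1 + (fourier (1 : ℤ) (y + s)).re) / 2)
      = (1 / 4 + 1 / 8 * w.re) + (1 / 4 * (fourier (1 : ℤ) y * 1).re
        + (1 / 4 * (fourier (1 : ℤ) y * w).re + 1 / 8 * (fourier (2 : ℤ) y * w).re)) := by
    have hz : ‖(fourier (1 : ℤ) y : ℂ)‖ = 1 := by rw [fourier_apply]; exact Circle.norm_coe _
    have h2 : (fourier (2 : ℤ) y : ℂ) = fourier (1 : ℤ) y * fourier (1 : ℤ) y := by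
      rw [← fourier_add, one_add_one_eq_two]
    have hs : (fourier (1 : ℤ) (y + s) : ℂ) = fourier (1 : ℤ) y * w := by
      simp only [w, fourier_apply, smul_add, AddCircle.toCircle_add, Circle.coe_mul]
    rw [h2, hs, mul_one]
    linear_combination (1 / 4) * Complex.re_mul_re_mul_of_norm_eq_one hz w
  simp_rw [hprod]
  have hi {g : AddCircle (1 : ℝ) → ℝ} (hg : Continuous g) : Integrable g :=
    hg.integrable_of_compactSpace
  rw [integral_add (hi (by fun_prop)) (hi (by fun_prop)),
    integral_add (hi (by fun_prop)) (hi (by fun_prop)),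
    integral_add (hi (by fun_prop)) (hi (by fun_prop)),
    integral_add (hi (by fun_prop)) (hi (by fun_prop))]
  simp only [integral_const_mul]
  rw [AddCircle.integral_re_mul_fourier_eq_zero one_ne_zero,
    AddCircle.integral_re_mul_fourier_eq_zero one_ne_zero,
    AddCircle.integral_re_mul_fourier_eq_zero two_ne_zero]
  simp [measureReal_def]

theorem stmt_16 (σ : Measure (AddCircle (1 : ℝ))) [IsProbabilityMeasure σ]
    (hsymm : σ.map (fun t => -t) = σ)
    (T : AddCircle (1 : ℝ) × AddCircle (1 : ℝ) → AddCircle (1 : ℝ) × AddCircle (1 : ℝ))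
    (hT : T = fun p => (p.1, p.2 + p.1))
    (μ : Measure (AddCircle (1 : ℝ) × AddCircle (1 : ℝ)))
    (hμ : μ = σ.prod volume)
    (f : AddCircle (1 : ℝ) × AddCircle (1 : ℝ) → ℝ)
    (hf : f = fun p => (1 + (fourier (1 : ℤ) p.2).re) / 2) :
    MeasurePreserving T μ μ ∧
    (∀ p, f p ∈ Set.Icc (0 : ℝ) 1) ∧
    (∫ p, f p ∂μ) = 1 / 2 ∧
    ∀ n : ℕ,
      (∫ p, f p * f (T^[n] p) ∂μ) - (∫ p, f p ∂μ) ^ 2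
        = (1 / 8) * ∫ t, (fourier (n : ℤ) t).re ∂σ := by
  have hiter (n : ℕ) (p) : T^[n] p = (p.1, p.2 + n • p.1) := by
    induction n with
    | zero => simp
    | succ n ih => rw [Function.iterate_succ_apply', ih, hT, succ_nsmul, ← add_assoc]
  have hmean : ∫ p, f p ∂μ = 1 / 2 := by
    subst hf hμ
    rw [integral_prod _ (Continuous.integrable_of_compactSpace (by fun_prop))]
    have h := AddCircle.integral_re_mul_fourier_eq_zero one_ne_zero 1
    simp only [mul_one] at h
    simp only [integral_div]
    rw [integral_add (integrable_const _) (Continuous.integrable_of_compactSpace (by fun_prop)), h]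
    simp [measureReal_def]
  refine ⟨?_, fun p => ?_, hmean, fun n => ?_⟩
  · subst hT hμ
    exact (MeasurePreserving.id σ).skew_product (g := fun x y => y + x) (by fun_prop)
      (ae_of_all _ fun x => (measurePreserving_add_right volume x).map_eq)
  · have h : |(fourier (1 : ℤ) p.2 : ℂ).re| ≤ 1 := by
      refine (Complex.abs_re_le_norm _).trans_eq ?_
      rw [fourier_apply]
      exact Circle.norm_coe _
    rw [abs_le] at h
    subst hf
    constructor <;> dsimp only <;> linarith [h.1, h.2]
  · rw [hmean]
    subst hf hμ
    simp only [hiter]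
    rw [integral_prod _ (Continuous.integrable_of_compactSpace (by fun_prop))]
    simp only [AddCircle.integral_shifted_cosine_product]
    have hn (t : AddCircle (1 : ℝ)) : (fourier (1 : ℤ) (n • t) : ℂ) = fourier (n : ℤ) t := by
      simp only [fourier_apply, one_smul, natCast_zsmul]
    simp only [hn]
    rw [integral_add (integrable_const _) (Continuous.integrable_of_compactSpace (by fun_prop)),
      integral_const_mul]
    simp
    ring
end

section
/- Let X = {0, 1, 2}^ℕ, let p₀, p₁, p₂ ∈ (0,1) with p₀ + p₁ + p₂ = 1, let μ be the infinite product on X of the probability measure on {0,1,2} assigning mass p_i to i, and let T : X → X be the one-sided shift (Tx)(k) = x(k+1). Let A := {x ∈ X : there exists n with x(k) = 0 for all k < n and x(n) = 1} (the first non-zero entry of x equals 1), and set a := p₁/(p₁ + p₂). Then μ(A) = a and μ(A ∩ T⁻ⁿA) = a² + p₀ⁿ·a·(1 − a) for every n ≥ 1; in particular 0 < μ(A) < 1 and μ(A ∩ T⁻ⁿA) > μ(A)² for every n ≥ 1, so A is strictly over-recurrent. -/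
open MeasureTheory

section Cylinders

variable {α : Type*} [MeasurableSpace α]

/-- The shift on one-sided sequences is measurable. -/
theorem measurable_shift : Measurable (fun (x : ℕ → α) k => x (k + 1)) :=
  measurable_pi_lambda _ fun k => measurable_pi_apply (k + 1)

/-- The initial cylinders of a sequence space form a π-system. -/
theorem isPiSystem_initialCylinders (α : Type*) :
    IsPiSystem {s : Set (ℕ → α) | ∃ (k : ℕ) (y : Fin k → α), s = {x | ∀ i : Fin k, x i = y i}} := by
  have key : ∀ (k l : ℕ) (y : Fin k → α) (z : Fin l → α), k ≤ l →
      ({x : ℕ → α | ∀ i : Fin k, x i = y i} ∩ {x | ∀ i : Fin l, x i = z i}).Nonempty →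
      {x : ℕ → α | ∀ i : Fin k, x i = y i} ∩ {x | ∀ i : Fin l, x i = z i} =
        {x | ∀ i : Fin l, x i = z i} := by
    rintro k l y z hkl ⟨w, hwy, hwz⟩
    refine Set.inter_eq_right.2 fun x hx i => ?_
    have hxi := hx (Fin.castLE hkl i)
    have hwi := hwz (Fin.castLE hkl i)
    simp only [Fin.val_castLE] at hxi hwi
    rw [hxi, ← hwi, hwy i]
  rintro _ ⟨k, y, rfl⟩ _ ⟨l, z, rfl⟩ hne
  rcases le_total k l with hkl | hkl
  · exact ⟨l, z, key k l y z hkl hne⟩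
  · rw [Set.inter_comm] at hne ⊢
    exact ⟨k, y, key l k z y hkl hne⟩

/-- The event that a given coordinate takes a given value is measurable. -/
theorem measurableSet_coordinate_eq [MeasurableSingletonClass α] (n : ℕ) (c : α) :
    MeasurableSet {x : ℕ → α | x n = c} := by
  change MeasurableSet ((fun x : ℕ → α => x n) ⁻¹' {c})
  exact measurable_pi_apply n (measurableSet_singleton c)

/-- Initial cylinders are measurable. -/
theorem measurableSet_initialCylinder [MeasurableSingletonClass α] (k : ℕ) (y : Fin k → α) :
    MeasurableSet {x : ℕ → α | ∀ i : Fin k, x i = y i} := by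
  rw [Set.ofPred_forall]
  exact MeasurableSet.iInter fun i => measurableSet_coordinate_eq i (y i)

/-- Over a finite alphabet the initial cylinders generate the product σ-algebra. -/
theorem generateFrom_initialCylinders (α : Type*) [Finite α] [MeasurableSpace α]
    [MeasurableSingletonClass α] :
    (MeasurableSpace.pi : MeasurableSpace (ℕ → α)) = MeasurableSpace.generateFrom
      {s | ∃ (k : ℕ) (y : Fin k → α), s = {x | ∀ i : Fin k, x i = y i}} := by
  apply le_antisymm
  · refine iSup_le fun n => ?_
    rintro _ ⟨t, -, rfl⟩
    have hcover : (fun x : ℕ → α => x n) ⁻¹' t =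
        ⋃ y ∈ {y : Fin (n + 1) → α | y (Fin.last n) ∈ t},
          {x : ℕ → α | ∀ i : Fin (n + 1), x i = y i} := by
      ext x
      simp only [Set.mem_preimage, Set.mem_iUnion, Set.mem_ofPred_eq, exists_prop]
      constructor
      · exact fun hx => ⟨fun i => x i, hx, fun _ => rfl⟩
      · rintro ⟨y, hy, hxy⟩
        rw [← hxy (Fin.last n)] at hy
        exact hy
    rw [hcover]
    exact MeasurableSet.biUnion (Set.to_countable _) fun y _ =>
      MeasurableSpace.measurableSet_generateFrom ⟨n + 1, y, rfl⟩
  · refine MeasurableSpace.generateFrom_le ?_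
    rintro _ ⟨k, y, rfl⟩
    exact measurableSet_initialCylinder k y

/-- Under a product measure the first coordinate is independent of the shifted sequence, which has
again the same law. -/
theorem measure_head_inter_shift_preimage [Finite α] [MeasurableSingletonClass α]
    {μ : Measure (ℕ → α)} [IsProbabilityMeasure μ] {w : α → ENNReal}
    (hcyl : ∀ (k : ℕ) (y : Fin k → α), μ {x | ∀ i : Fin k, x i = y i} = ∏ i, w (y i))
    (c : α) {B : Set (ℕ → α)} (hB : MeasurableSet B) :
    μ ({x | x 0 = c} ∩ (fun x k => x (k + 1)) ⁻¹' B) = w c * μ B := by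
  have hhead : MeasurableSet {x : ℕ → α | x 0 = c} := measurableSet_coordinate_eq 0 c
  have hcons : ∀ (k : ℕ) (y : Fin k → α),
      (μ.restrict {x | x 0 = c}).map (fun x k => x (k + 1)) {x | ∀ i : Fin k, x i = y i} =
        w c * ∏ i, w (y i) := by
    intro k y
    have hm := measurableSet_initialCylinder k y
    rw [Measure.map_apply measurable_shift hm, Measure.restrict_apply (measurable_shift hm)]
    have h := hcyl (k + 1) (Fin.cons c y)
    simp only [Fin.forall_fin_succ, Fin.prod_univ_succ, Fin.cons_zero, Fin.cons_succ,
      Fin.val_zero, Fin.val_succ] at h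
    rw [← h, Set.inter_comm]
    rfl
  have huniv : (μ.restrict {x | x 0 = c}).map (fun x k => x (k + 1)) Set.univ = w c := by
    simpa using hcons 0 Fin.elim0
  have heq : (μ.restrict {x | x 0 = c}).map (fun x k => x (k + 1)) = w c • μ := by
    refine ext_of_generate_finite _ (generateFrom_initialCylinders α)
      (isPiSystem_initialCylinders α) ?_ ?_
    · rintro _ ⟨k, y, rfl⟩
      rw [hcons, Measure.smul_apply, hcyl, smul_eq_mul]
    · rw [huniv, Measure.smul_apply, measure_univ, smul_eq_mul, mul_one]
  have h := congrArg (fun ν => ν B) heq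
  simp only [Measure.map_apply measurable_shift hB,
    Measure.restrict_apply (measurable_shift hB), Measure.smul_apply, smul_eq_mul] at h
  rw [Set.inter_comm, h]

/-- Product measures are invariant under the shift. -/
theorem measurePreserving_shift [Fintype α] [MeasurableSingletonClass α]
    {μ : Measure (ℕ → α)} [IsProbabilityMeasure μ] {w : α → ENNReal}
    (hcyl : ∀ (k : ℕ) (y : Fin k → α), μ {x | ∀ i : Fin k, x i = y i} = ∏ i, w (y i)) :
    MeasurePreserving (fun (x : ℕ → α) k => x (k + 1)) μ μ := by
  have hpart : ∀ B : Set (ℕ → α), MeasurableSet B →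
      μ ((fun x k => x (k + 1)) ⁻¹' B) = (∑ c, w c) * μ B := by
    intro B hB
    have hunion : (fun (x : ℕ → α) k => x (k + 1)) ⁻¹' B =
        ⋃ c, {x | x 0 = c} ∩ (fun x k => x (k + 1)) ⁻¹' B := by
      ext x
      simp
    rw [hunion, measure_iUnion, tsum_fintype, Finset.sum_mul]
    · exact Finset.sum_congr rfl fun c _ => measure_head_inter_shift_preimage hcyl c hB
    · intro c d hcd
      refine Set.disjoint_left.2 ?_
      rintro x ⟨hc, -⟩ ⟨hd, -⟩
      exact hcd (hc.symm.trans hd)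
    · exact fun c => (measurableSet_coordinate_eq 0 c).inter (measurable_shift hB)
  have htotal : ∑ c, w c = 1 := by
    simpa using (hpart Set.univ MeasurableSet.univ).symm
  refine ⟨measurable_shift, Measure.ext fun B hB => ?_⟩
  rw [Measure.map_apply measurable_shift hB, hpart B hB, htotal, one_mul]

end Cylinders

/-- The event that the first non-zero entry of a sequence equals one, split by the first entry. -/
theorem mem_firstNonzeroEqOne_iff (x : ℕ → Fin 3) :
    (∃ n : ℕ, (∀ k < n, x k = 0) ∧ x n = 1) ↔
      x 0 = 1 ∨ x 0 = 0 ∧ ∃ n : ℕ, (∀ k < n, x (k + 1) = 0) ∧ x (n + 1) = 1 := by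
  constructor
  · rintro ⟨_ | n, hz, ho⟩
    · exact Or.inl ho
    · exact Or.inr ⟨hz 0 n.succ_pos, n, fun k hk => hz (k + 1) (by omega), ho⟩
  · rintro (h | ⟨h, n, hz, ho⟩)
    · exact ⟨0, by simp, h⟩
    · refine ⟨n + 1, ?_, ho⟩
      rintro (_ | k) hk
      · exact h
      · exact hz k (by omega)

theorem stmt_18 (p₀ p₁ p₂ : ℝ)
    (h₀ : p₀ ∈ Set.Ioo (0 : ℝ) 1) (h₁ : p₁ ∈ Set.Ioo (0 : ℝ) 1) (h₂ : p₂ ∈ Set.Ioo (0 : ℝ) 1)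
    (hsum : p₀ + p₁ + p₂ = 1)
    (μ : Measure (ℕ → Fin 3)) [IsProbabilityMeasure μ]
    -- μ is the infinite product measure: its values on cylinders are products
    (hcyl : ∀ (k : ℕ) (y : Fin k → Fin 3),
      μ {x | ∀ i : Fin k, x (i : ℕ) = y i} = ∏ i, ENNReal.ofReal (![p₀, p₁, p₂] (y i)))
    (T : (ℕ → Fin 3) → (ℕ → Fin 3)) (hT : T = fun x k => x (k + 1))
    (A : Set (ℕ → Fin 3))
    (hA : A = {x | ∃ n : ℕ, (∀ k < n, x k = 0) ∧ x n = 1})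
    (a : ℝ) (ha : a = p₁ / (p₁ + p₂)) :
    μ A = ENNReal.ofReal a ∧
    (∀ n : ℕ, 1 ≤ n →
      μ (A ∩ T^[n] ⁻¹' A) = ENNReal.ofReal (a ^ 2 + p₀ ^ n * a * (1 - a))) ∧
    0 < μ A ∧ μ A < 1 ∧
    (∀ n : ℕ, 1 ≤ n → μ (A ∩ T^[n] ⁻¹' A) > μ A ^ 2) := by
  obtain ⟨h₀, h₀'⟩ := h₀
  obtain ⟨h₁, -⟩ := h₁
  obtain ⟨h₂, -⟩ := h₂
  have ha_mul : a * (p₁ + p₂) = p₁ := by rw [ha]; field_simp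
  have ha_pos : 0 < a := by rw [ha]; positivity
  have ha_lt : a < 1 := by rw [ha, div_lt_one (by positivity)]; linarith
  have ha_fix : p₁ + p₀ * a = a := by linear_combination a * hsum - ha_mul
  have hmp : MeasurePreserving T μ μ := hT ▸
    measurePreserving_shift (w := fun c => ENNReal.ofReal (![p₀, p₁, p₂] c)) hcyl
  have hA_meas : MeasurableSet A := by
    rw [hA]
    simp only [Set.ofPred_exists, Set.ofPred_and, Set.ofPred_forall]
    exact MeasurableSet.iUnion fun n => (MeasurableSet.iInter fun k => MeasurableSet.iInter
      fun _ => measurableSet_coordinate_eq k 0).inter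
        (measurableSet_coordinate_eq n 1)
  have hstep : ∀ (c : Fin 3) (B : Set (ℕ → Fin 3)), MeasurableSet B →
      μ.real ({x | x 0 = c} ∩ T ⁻¹' B) = ![p₀, p₁, p₂] c * μ.real B := by
    intro c B hB
    have hc : 0 ≤ ![p₀, p₁, p₂] c := by fin_cases c <;> simp <;> positivity
    rw [hT, measureReal_def, measure_head_inter_shift_preimage
      (w := fun c => ENNReal.ofReal (![p₀, p₁, p₂] c)) hcyl c hB, ENNReal.toReal_mul,
      ENNReal.toReal_ofReal hc, measureReal_def]
  have hsplit : ∀ B : Set (ℕ → Fin 3), MeasurableSet B →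
      μ.real (A ∩ T ⁻¹' B) = p₁ * μ.real B + p₀ * μ.real (A ∩ B) := by
    intro B hB
    have hunion : A ∩ T ⁻¹' B = {x | x 0 = 1} ∩ T ⁻¹' B ∪ {x | x 0 = 0} ∩ T ⁻¹' (A ∩ B) := by
      ext x
      simp only [hA, hT, Set.mem_inter_iff, Set.mem_union, Set.mem_preimage, Set.mem_ofPred_eq,
        mem_firstNonzeroEqOne_iff x]
      tauto
    rw [hunion, measureReal_union, hstep 1 B hB, hstep 0 _ (hA_meas.inter hB)]
    · simp
    · refine Set.disjoint_left.2 ?_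
      rintro x ⟨hx, -⟩ ⟨hx', -⟩
      exact absurd (hx.symm.trans hx') (by decide)
    · exact (measurableSet_coordinate_eq 0 0).inter
        (hmp.measurable (hA_meas.inter hB))
  have hreal : μ.real A = a := by
    have h := hsplit Set.univ MeasurableSet.univ
    simp only [Set.preimage_univ, Set.inter_univ, probReal_univ, mul_one] at h
    have hne : 1 - p₀ ≠ 0 := by linarith
    exact mul_left_cancel₀ hne (by linear_combination h + ha_fix)
  have hcorr : ∀ n : ℕ, μ.real (A ∩ T^[n] ⁻¹' A) = a ^ 2 + p₀ ^ n * a * (1 - a) := by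
    intro n
    induction n with
    | zero => simp [hreal]; ring
    | succ n ih =>
      have hn := hmp.iterate n
      rw [Function.iterate_succ, Set.preimage_comp, hsplit _ (hn.measurable hA_meas), ih,
        hn.measureReal_preimage hA_meas.nullMeasurableSet, hreal]
      linear_combination a * ha_fix
  have hμA : μ A = ENNReal.ofReal a := by rw [← hreal, ofReal_measureReal]
  have hμcorr : ∀ n : ℕ,
      μ (A ∩ T^[n] ⁻¹' A) = ENNReal.ofReal (a ^ 2 + p₀ ^ n * a * (1 - a)) := fun n => by
    rw [← hcorr, ofReal_measureReal]
  refine ⟨hμA, fun n _ => hμcorr n, ?_, ?_, fun n _ => ?_⟩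
  · rwa [hμA, ENNReal.ofReal_pos]
  · rwa [hμA, ENNReal.ofReal_lt_one]
  · have hgap : 0 < p₀ ^ n * a * (1 - a) := mul_pos (by positivity) (by linarith)
    rw [hμcorr, hμA, ← ENNReal.ofReal_pow ha_pos.le, gt_iff_lt,
      ENNReal.ofReal_lt_ofReal_iff (by positivity)]
    linarith
end

section
/- Let X = {0, 1, 2}^ℕ, let s ∈ (0, 1/2), set p₀ = s/4, p₁ = 1 − s, p₂ = 3s/4, let μ be the infinite product on X of the probability measure on {0,1,2} assigning mass p_i to i, and let T : X → X be the one-sided shift (Tx)(k) = x(k+1). Let A be the set of x ∈ X whose first two non-zero entries are, in order, 1 and 2 (i.e. there exist k < l with x(j) = 0 for all j < l with j ≠ k, x(k) = 1, and x(l) = 2), and set a := p₁p₂/(p₁ + p₂)². Then μ(A) = a, and for every n ≥ 1, μ(A ∩ T⁻ⁿA) = a²·(1 + n·p₀ⁿ − n·p₀^{n−1} − p₀ⁿ) + a·p₀ⁿ; moreover μ(A ∩ T⁻ⁿA) < μ(A)² for every n ≥ 1, so A is strictly under-recurrent. -/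
open MeasureTheory

/-- Prepend a letter to a one-sided sequence. -/
def prepend {α : Type*} (i : α) (x : ℕ → α) : ℕ → α
  | 0 => i
  | k + 1 => x k

lemma measurable_prepend {α : Type*} [MeasurableSpace α] (i : α) :
    Measurable (prepend i) := by
  refine measurable_pi_lambda _ fun k => ?_
  cases k with
  | zero => exact measurable_const
  | succ k => exact measurable_pi_apply k

lemma measurable_apply_eq {α : Type*} [MeasurableSpace α] [MeasurableSingletonClass α]
    (k : ℕ) (i : α) : Measurable fun x : ℕ → α => x k = i :=
  measurableSet_setOfPred.1 <| (measurableSet_singleton i).preimage (measurable_pi_apply k)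

lemma measurableSet_initial_cylinder {α : Type*} [MeasurableSpace α]
    [MeasurableSingletonClass α] (k : ℕ) (y : Fin k → α) :
    MeasurableSet {x : ℕ → α | ∀ i : Fin k, x (i : ℕ) = y i} :=
  measurableSet_setOfPred.2 <| .forall fun i => measurable_apply_eq (i : ℕ) (y i)

/-- Finite measures on one-sided sequences over a finite alphabet are determined by their values
on initial cylinders. -/
lemma ext_of_initial_cylinders {α : Type*} [Finite α] [MeasurableSpace α]
    [MeasurableSingletonClass α] (μ ν : Measure (ℕ → α)) [IsFiniteMeasure μ]
    (h : ∀ (k : ℕ) (y : Fin k → α),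
      μ {x | ∀ i : Fin k, x (i : ℕ) = y i} = ν {x | ∀ i : Fin k, x (i : ℕ) = y i}) :
    μ = ν := by
  refine ext_of_generate_finite
    {S | ∃ (k : ℕ) (y : Fin k → α), S = {x | ∀ i : Fin k, x (i : ℕ) = y i}} ?_ ?_ ?_ ?_
  · apply le_antisymm
    · refine iSup_le fun i => ?_
      rw [← measurable_iff_comap_le]
      refine @measurable_to_countable' _ _ _ _ (_) _ fun j => ?_
      have hunion : (fun x : ℕ → α => x i) ⁻¹' {j} =
          ⋃ y : {y : Fin (i + 1) → α // y (Fin.last i) = j},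
            {x | ∀ m : Fin (i + 1), x (m : ℕ) = y.1 m} := by
        ext x
        simp only [Set.mem_preimage, Set.mem_singleton_iff, Set.mem_iUnion, Set.mem_ofPred_eq]
        constructor
        · intro hx
          exact ⟨⟨fun m => x m, by simpa using hx⟩, fun m => rfl⟩
        · rintro ⟨⟨y, hy⟩, hx⟩
          simpa [hy] using hx (Fin.last i)
      rw [hunion]
      exact MeasurableSet.iUnion fun y => MeasurableSpace.measurableSet_generateFrom ⟨_, _, rfl⟩
    · refine MeasurableSpace.generateFrom_le ?_
      rintro _ ⟨k, y, rfl⟩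
      exact measurableSet_initial_cylinder k y
  · rintro _ ⟨k, y, rfl⟩ _ ⟨l, z, rfl⟩ ⟨w, hwy, hwz⟩
    refine ⟨max k l, fun i => w i, ?_⟩
    ext x
    simp only [Set.mem_inter_iff, Set.mem_ofPred_eq] at hwy hwz ⊢
    constructor
    · rintro ⟨hy, hz⟩ ⟨i, hi⟩
      rcases lt_max_iff.1 hi with hi | hi
      · exact (hy ⟨i, hi⟩).trans (hwy ⟨i, hi⟩).symm
      · exact (hz ⟨i, hi⟩).trans (hwz ⟨i, hi⟩).symm
    · intro hx
      exact ⟨fun i => (hx ⟨i, lt_max_of_lt_left i.2⟩).trans (hwy i),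
        fun i => (hx ⟨i, lt_max_of_lt_right i.2⟩).trans (hwz i)⟩
  · rintro _ ⟨k, y, rfl⟩
    exact h k y
  · simpa using h 0 Fin.elim0

/-- A Bernoulli measure is the mixture, over the first letter, of its images under prepending
that letter. -/
lemma eq_sum_map_prepend {α : Type*} [Fintype α] [MeasurableSpace α]
    [MeasurableSingletonClass α] (w : α → ENNReal) (hw : ∑ i, w i = 1)
    (μ : Measure (ℕ → α)) [IsProbabilityMeasure μ]
    (hcyl : ∀ (k : ℕ) (y : Fin k → α),
      μ {x | ∀ i : Fin k, x (i : ℕ) = y i} = ∏ i, w (y i)) :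
    μ = ∑ i, w i • μ.map (prepend i) := by
  classical
  refine ext_of_initial_cylinders _ _ fun k y => ?_
  simp only [Measure.finsetSum_apply, Measure.smul_apply, smul_eq_mul,
    Measure.map_apply (measurable_prepend _) (measurableSet_initial_cylinder k y)]
  cases k with
  | zero => simp [hw]
  | succ k =>
    rw [hcyl, Fin.prod_univ_succ, Finset.sum_eq_single (y 0)]
    · congr 1
      rw [← hcyl k fun i => y i.succ]
      congr 1
      ext x
      simp [Fin.forall_fin_succ, prepend]
    · intro i _ hi
      have : prepend i ⁻¹' {x | ∀ m : Fin (k + 1), x (m : ℕ) = y m} = ∅ := by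
        ext x
        simp [Fin.forall_fin_succ, prepend, hi]
      simp [this]
    · simp

/-- First-letter decomposition of the probability of an event under a Bernoulli measure. -/
lemma measureReal_eq_sum_prepend {α : Type*} [Fintype α] [MeasurableSpace α]
    [MeasurableSingletonClass α] (p : α → ℝ) (hp : ∀ i, 0 ≤ p i) (hsum : ∑ i, p i = 1)
    (μ : Measure (ℕ → α)) [IsProbabilityMeasure μ]
    (hcyl : ∀ (k : ℕ) (y : Fin k → α),
      μ {x | ∀ i : Fin k, x (i : ℕ) = y i} = ∏ i, ENNReal.ofReal (p (y i)))
    {S : Set (ℕ → α)} (hS : MeasurableSet S) :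
    μ.real S = ∑ i, p i * μ.real (prepend i ⁻¹' S) := by
  have hw : ∑ i, ENNReal.ofReal (p i) = 1 := by
    rw [← ENNReal.ofReal_sum_of_nonneg fun i _ => hp i, hsum, ENNReal.ofReal_one]
  have hμ := congrArg (fun ν : Measure (ℕ → α) => (ν S).toReal)
    (eq_sum_map_prepend (fun i => ENNReal.ofReal (p i)) hw μ hcyl)
  simp only [Measure.finsetSum_apply, Measure.smul_apply, smul_eq_mul,
    Measure.map_apply (measurable_prepend _) hS] at hμ
  rw [ENNReal.toReal_sum fun i _ => ENNReal.mul_ne_top ENNReal.ofReal_ne_top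
    (measure_ne_top _ _)] at hμ
  simpa [Measure.real, ENNReal.toReal_mul, ENNReal.toReal_ofReal (hp _)] using hμ

/-- The sequences whose first non-zero letter is `2`. -/
def firstNonzeroTwo : Set (ℕ → Fin 3) :=
  {x | ∃ l : ℕ, x l = 2 ∧ ∀ j < l, x j = 0}

/-- The sequences whose first two non-zero letters are `1` and `2`, in this order. -/
def firstNonzeroOneTwo : Set (ℕ → Fin 3) :=
  {x | ∃ k l : ℕ, k < l ∧ x k = 1 ∧ x l = 2 ∧ ∀ j < l, j ≠ k → x j = 0}

lemma measurableSet_firstNonzeroTwo : MeasurableSet firstNonzeroTwo :=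
  measurableSet_setOfPred.2 <| .exists fun _ => (measurable_apply_eq _ _).and <|
    .forall fun _ => .forall fun _ => (measurable_apply_eq _ _)

lemma measurableSet_firstNonzeroOneTwo : MeasurableSet firstNonzeroOneTwo :=
  measurableSet_setOfPred.2 <| .exists fun _ => .exists fun _ => measurable_const.and <|
    (measurable_apply_eq _ _).and <| (measurable_apply_eq _ _).and <|
    .forall fun _ => .forall fun _ => .forall fun _ => (measurable_apply_eq _ _)

lemma prepend_mem_firstNonzeroTwo (i : Fin 3) (x : ℕ → Fin 3) :
    prepend i x ∈ firstNonzeroTwo ↔ i = 2 ∨ i = 0 ∧ x ∈ firstNonzeroTwo := by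
  constructor
  · rintro ⟨_ | l, hl, h⟩
    · exact .inl hl
    · exact .inr ⟨h 0 l.succ_pos, l, hl, fun j hj => h (j + 1) (by omega)⟩
  · rintro (rfl | ⟨rfl, l, hl, h⟩)
    · exact ⟨0, rfl, by simp⟩
    · refine ⟨l + 1, hl, ?_⟩
      rintro (_ | j) hj
      · rfl
      · exact h j (by omega)

lemma prepend_mem_firstNonzeroOneTwo (i : Fin 3) (x : ℕ → Fin 3) :
    prepend i x ∈ firstNonzeroOneTwo ↔
      i = 0 ∧ x ∈ firstNonzeroOneTwo ∨ i = 1 ∧ x ∈ firstNonzeroTwo := by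
  constructor
  · rintro ⟨_ | k, _ | l, hkl, hk, hl, h⟩
    · omega
    · exact .inr ⟨hk, l, hl, fun j hj => h (j + 1) (by omega) (by omega)⟩
    · omega
    · exact .inl ⟨h 0 (by omega) (by omega), k, l, by omega, hk, hl,
        fun j hj hjk => h (j + 1) (by omega) (by omega)⟩
  · rintro (⟨rfl, k, l, hkl, hk, hl, h⟩ | ⟨rfl, l, hl, h⟩)
    · refine ⟨k + 1, l + 1, by omega, hk, hl, ?_⟩
      rintro (_ | j) hj hjk
      · rfl
      · exact h j (by omega) (by omega)
    · refine ⟨0, l + 1, by omega, rfl, hl, ?_⟩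
      rintro (_ | j) hj hj0
      · omega
      · exact h j (by omega)

lemma disjoint_firstNonzeroTwo_firstNonzeroOneTwo :
    Disjoint firstNonzeroTwo firstNonzeroOneTwo := by
  rw [Set.disjoint_left]
  rintro x ⟨m, hm, hx⟩ ⟨k, l, hkl, hk, hl, h⟩
  rcases lt_trichotomy m k with hmk | rfl | hkm
  · have := h m (by omega) (by omega)
    simp_all
  · simp_all
  · have := hx k hkm
    simp_all

theorem stmt_19 (s : ℝ) (hs : s ∈ Set.Ioo (0 : ℝ) (1 / 2))
    (p₀ p₁ p₂ : ℝ) (hp₀ : p₀ = s / 4) (hp₁ : p₁ = 1 - s) (hp₂ : p₂ = 3 * s / 4)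
    (μ : Measure (ℕ → Fin 3)) [IsProbabilityMeasure μ]
    -- μ is the infinite product measure: its values on cylinders are products
    (hcyl : ∀ (k : ℕ) (y : Fin k → Fin 3),
      μ {x | ∀ i : Fin k, x (i : ℕ) = y i} = ∏ i, ENNReal.ofReal (![p₀, p₁, p₂] (y i)))
    (T : (ℕ → Fin 3) → (ℕ → Fin 3)) (hT : T = fun x k => x (k + 1))
    (A : Set (ℕ → Fin 3))
    (hA : A = {x | ∃ k l : ℕ, k < l ∧ x k = 1 ∧ x l = 2 ∧
      ∀ j < l, j ≠ k → x j = 0})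
    (a : ℝ) (ha : a = p₁ * p₂ / (p₁ + p₂) ^ 2) :
    μ A = ENNReal.ofReal a ∧
    (∀ n : ℕ, 1 ≤ n →
      μ (A ∩ T^[n] ⁻¹' A)
        = ENNReal.ofReal
            (a ^ 2 * (1 + n * p₀ ^ n - n * p₀ ^ (n - 1) - p₀ ^ n) + a * p₀ ^ n)) ∧
    0 < μ A ∧ μ A < 1 ∧
    (∀ n : ℕ, 1 ≤ n → μ (A ∩ T^[n] ⁻¹' A) < μ A ^ 2) := by
  obtain ⟨hs0, hs1⟩ := hs
  change A = firstNonzeroOneTwo at hA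
  subst hA
  set A := firstNonzeroOneTwo with hA
  set B := firstNonzeroTwo with hB
  have hp0 : 0 < p₀ := by linarith
  have hp1 : 0 < p₁ := by linarith
  have hp2 : 0 < p₂ := by linarith
  have hq : p₁ + p₂ = 1 - p₀ := by linarith
  have hq0 : 0 < 1 - p₀ := by linarith
  have hAm : MeasurableSet A := measurableSet_firstNonzeroOneTwo
  have hBm : MeasurableSet B := measurableSet_firstNonzeroTwo
  have hTm : Measurable T := by
    rw [hT]
    exact measurable_pi_lambda _ fun k => measurable_pi_apply (k + 1)
  have hTprep (i : Fin 3) (x : ℕ → Fin 3) : T (prepend i x) = x := by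
    rw [hT]; rfl
  have hsplit {S : Set (ℕ → Fin 3)} (hS : MeasurableSet S) :
      μ.real S = p₀ * μ.real (prepend 0 ⁻¹' S) + p₁ * μ.real (prepend 1 ⁻¹' S) +
        p₂ * μ.real (prepend 2 ⁻¹' S) := by
    rw [measureReal_eq_sum_prepend ![p₀, p₁, p₂] ?_ ?_ μ hcyl hS, Fin.sum_univ_three]
    · rfl
    · intro i
      fin_cases i
      exacts [hp0.le, hp1.le, hp2.le]
    · simp only [Fin.sum_univ_three, Matrix.cons_val]
      linarith
  have hprepA0 (S : Set (ℕ → Fin 3)) :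
      prepend 0 ⁻¹' (A ∩ T ⁻¹' S) = A ∩ S := by
    ext x; simp [hA, prepend_mem_firstNonzeroOneTwo, hTprep]
  have hprepA1 (S : Set (ℕ → Fin 3)) :
      prepend 1 ⁻¹' (A ∩ T ⁻¹' S) = B ∩ S := by
    ext x; simp [hA, hB, prepend_mem_firstNonzeroOneTwo, hTprep]
  have hprepA2 (S : Set (ℕ → Fin 3)) :
      prepend 2 ⁻¹' (A ∩ T ⁻¹' S) = ∅ := by
    ext x; simp [hA, prepend_mem_firstNonzeroOneTwo]
  have hprepB0 (S : Set (ℕ → Fin 3)) :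
      prepend 0 ⁻¹' (B ∩ T ⁻¹' S) = B ∩ S := by
    ext x; simp [hB, prepend_mem_firstNonzeroTwo, hTprep]
  have hprepB1 (S : Set (ℕ → Fin 3)) :
      prepend 1 ⁻¹' (B ∩ T ⁻¹' S) = ∅ := by
    ext x; simp [hB, prepend_mem_firstNonzeroTwo]
  have hprepB2 (S : Set (ℕ → Fin 3)) :
      prepend 2 ⁻¹' (B ∩ T ⁻¹' S) = S := by
    ext x; simp [hB, prepend_mem_firstNonzeroTwo, hTprep]
  have hrecA {S : Set (ℕ → Fin 3)} (hS : MeasurableSet S) :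
      μ.real (A ∩ T ⁻¹' S) = p₀ * μ.real (A ∩ S) + p₁ * μ.real (B ∩ S) := by
    rw [hsplit (hAm.inter (hTm hS)), hprepA0, hprepA1, hprepA2]
    simp
  have hrecB {S : Set (ℕ → Fin 3)} (hS : MeasurableSet S) :
      μ.real (B ∩ T ⁻¹' S) = p₀ * μ.real (B ∩ S) + p₂ * μ.real S := by
    rw [hsplit (hBm.inter (hTm hS)), hprepB0, hprepB1, hprepB2]
    simp
  have hinv {S : Set (ℕ → Fin 3)} (hS : MeasurableSet S) : μ.real (T ⁻¹' S) = μ.real S := by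
    have hpre (i : Fin 3) : prepend i ⁻¹' (T ⁻¹' S) = S := by
      ext x; simp [hTprep]
    rw [hsplit (hTm hS), hpre, hpre, hpre]
    linear_combination μ.real S * hq
  have hBreal : μ.real B * (1 - p₀) = p₂ := by
    have := hrecB MeasurableSet.univ
    simp only [Set.preimage_univ, Set.inter_univ, probReal_univ] at this
    linarith
  have hAreal : μ.real A = a := by
    have h := hrecA MeasurableSet.univ
    simp only [Set.preimage_univ, Set.inter_univ] at h
    rw [ha, hq, eq_div_iff (by positivity)]
    linear_combination (1 - p₀) * h + p₁ * hBreal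
  have haq : a * (1 - p₀) ^ 2 = p₁ * p₂ := by
    rw [ha, hq, div_mul_cancel₀ _ (by positivity)]
  have hiter (n : ℕ) : MeasurableSet (T^[n] ⁻¹' A) := hTm.iterate n hAm
  have hsucc (n : ℕ) : T^[n + 1] ⁻¹' A = T ⁻¹' (T^[n] ⁻¹' A) := by
    rw [Function.iterate_succ, Set.preimage_comp]
  have hiterA (n : ℕ) : μ.real (T^[n] ⁻¹' A) = a := by
    induction n with
    | zero => simpa using hAreal
    | succ n ih => rw [hsucc, hinv (hiter n), ih]
  have hiterB (n : ℕ) :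
      μ.real (B ∩ T^[n] ⁻¹' A) * (1 - p₀) = p₂ * a * (1 - p₀ ^ n) := by
    induction n with
    | zero =>
      simp [hA, hB, disjoint_firstNonzeroTwo_firstNonzeroOneTwo.inter_eq]
    | succ n ih =>
      rw [hsucc, hrecB (hiter n), hiterA, pow_succ]
      linear_combination p₀ * ih
  have hmain (n : ℕ) : μ.real (A ∩ T^[n] ⁻¹' A) =
      a ^ 2 * (1 + n * p₀ ^ n - n * p₀ ^ (n - 1) - p₀ ^ n) + a * p₀ ^ n := by
    induction n with
    | zero => simp [hAreal]
    | succ n ih =>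
      have hpow : (n : ℝ) * p₀ ^ n = p₀ * (n * p₀ ^ (n - 1)) := by
        cases n with
        | zero => simp
        | succ n => rw [Nat.add_sub_cancel, pow_succ]; ring
      rw [hsucc, hrecA (hiter n), ih, Nat.add_sub_cancel, pow_succ, Nat.cast_succ]
      apply mul_right_cancel₀ hq0.ne'
      linear_combination p₁ * hiterB n - a * (1 - p₀ ^ n) * haq +
        a ^ 2 * (1 - p₀) * hpow
  have ha0 : 0 < a := by rw [ha]; positivity
  have hpa : p₀ < a := by
    rw [ha, hq, lt_div_iff₀ (by positivity), hp₀, hp₁, hp₂]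
    nlinarith [mul_pos hs0 hs0, mul_pos hs0 (sub_pos.2 hs1),
      mul_pos (mul_pos hs0 hs0) (sub_pos.2 hs1)]
  have ha1 : a < 1 := by
    rw [ha, div_lt_one (by positivity)]
    nlinarith [mul_pos hp1 hp2, mul_pos hp1 hp1, mul_pos hp2 hp2]
  have hreal (S : Set (ℕ → Fin 3)) : μ S = ENNReal.ofReal (μ.real S) :=
    (ofReal_measureReal (measure_ne_top μ S)).symm
  refine ⟨by rw [hreal, hAreal], fun n _ => by rw [hreal, hmain], ?_, ?_, fun n hn => ?_⟩
  · rwa [hreal, hAreal, ENNReal.ofReal_pos]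
  · rwa [hreal, hAreal, ENNReal.ofReal_lt_one]
  · rw [hreal, hreal A, hAreal, hmain, ← ENNReal.ofReal_pow ha0.le,
      ENNReal.ofReal_lt_ofReal_iff (by positivity)]
    obtain ⟨m, rfl⟩ : ∃ m, n = m + 1 := ⟨n - 1, by omega⟩
    rw [Nat.add_sub_cancel, pow_succ, Nat.cast_succ]
    have hfactor : 0 < a * (1 + m * (1 - p₀)) - p₀ := by
      have : 0 ≤ a * (m * (1 - p₀)) := by positivity
      linarith
    have := mul_pos (mul_pos ha0 (pow_pos hp0 m)) hfactor
    linear_combination this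
end
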